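/- arXiv:2210.03891 — 4 statements merged into one kernel-verified Lean document; each statement's English description precedes it below -/
import Mathlib

section
/- Let R be a commutative Noetherian ring and let M be a finitely generated R-submodule of the total ring of fractions Q(R) containing the image of a non-zero-divisor of R. Then the trace ideal Tr_R(M) equals the intersection, taken over all integers i ≥ 1 and all (not necessarily finitely generated) R-modules N, of the annihilators ann_R Tor_i^R(M, N). -/
open CategoryTheory Opposite

universe u

/-- The trace ideal of an `R`-module `M`: the ideal of `R` generated by the images of all
`R`-linear maps `M → R`. -/
noncomputable def traceIdeal (R : Type u) [CommRing R] (M : Type u)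
    [AddCommGroup M] [Module R M] : Ideal R :=
  ⨆ f : M →ₗ[R] R, LinearMap.range f

open scoped TensorProduct

lemma sc_ann {R : Type u} [CommRing R] (S : ShortComplex (ModuleCat.{u} R)) (r : R) :
    r ∈ Module.annihilator R S.homology ↔
      ∀ x : S.X₂, S.g.hom x = 0 → ∃ y : S.X₁, S.f.hom y = r • x := by
  rw [(S.moduleCatHomologyIso.toLinearEquiv).annihilator_eq]
  rw [Module.mem_annihilator]
  constructor
  · intro h x hx
    have := h (Submodule.Quotient.mk (⟨x, hx⟩ : LinearMap.ker S.g.hom))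
    have h2 := (Submodule.Quotient.mk_eq_zero (LinearMap.range S.moduleCatToCycles) (x := r • (⟨x, hx⟩ : LinearMap.ker S.g.hom))).1 this
    obtain ⟨y, hy⟩ := h2
    exact ⟨y, congrArg Subtype.val hy⟩
  · intro h m
    obtain ⟨⟨x, hx⟩, rfl⟩ := Submodule.Quotient.mk_surjective _ m
    obtain ⟨y, hy⟩ := h x hx
    refine (Submodule.Quotient.mk_eq_zero (LinearMap.range S.moduleCatToCycles) (x := r • (⟨x, hx⟩ : LinearMap.ker S.g.hom))).2 ⟨y, Subtype.ext hy⟩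

lemma tor_ann {R : Type u} [CommRing R] (M N : ModuleCat.{u} R) (P : ProjectiveResolution N)
    (j : ℕ) (r : R) :
    r ∈ Module.annihilator R (((Tor (ModuleCat.{u} R) (j+1)).obj M).obj N) ↔
      ∀ x : M ⊗[R] (P.complex.X (j+1)), (P.complex.d (j+1) j).hom.lTensor M x = 0 →
        ∃ y : M ⊗[R] (P.complex.X (j+2)),
          (P.complex.d (j+2) (j+1)).hom.lTensor M y = r • x := by
  have e1 := P.isoLeftDerivedObj ((MonoidalCategory.tensoringLeft (ModuleCat.{u} R)).obj M) (j+1)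
  have e2 := ShortComplex.homologyMapIso (HomologicalComplex.isoSc' ((((MonoidalCategory.tensoringLeft (ModuleCat.{u} R)).obj M).mapHomologicalComplex _).obj P.complex) (j+2) (j+1) j
    (by simp only [ChainComplex.prev]; rfl) (by simp))
  have e := e1 ≪≫ e2
  rw [Tor_obj, e.toLinearEquiv.annihilator_eq, sc_ann]
  exact Iff.rfl

lemma res_exact {R : Type u} [CommRing R] {N : ModuleCat.{u} R} (P : ProjectiveResolution N) (j : ℕ) :
   Function.Exact (P.complex.d (j+2) (j+1)).hom (P.complex.d (j+1) j).hom :=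
  (ShortComplex.ShortExact.moduleCat_exact_iff_function_exact _).mp (P.exact_succ j)

lemma res_exact0 {R : Type u} [CommRing R] {N : ModuleCat.{u} R} (P : ProjectiveResolution N) :
   ∃ q : P.complex.X 0 →ₗ[R] N, Function.Exact (P.complex.d 1 0).hom q ∧ Function.Surjective q :=
  ⟨(P.π.f 0).hom, (ShortComplex.ShortExact.moduleCat_exact_iff_function_exact _).mp P.exact₀,
    (ModuleCat.epi_iff_surjective _).1 (inferInstance : Epi (P.π.f 0))⟩

lemma res_flat {R : Type u} [CommRing R] {N : ModuleCat.{u} R} (P : ProjectiveResolution N) (j : ℕ) :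
   Module.Flat R (P.complex.X j) := by
  have : Module.Projective R (P.complex.X j) := (IsProjective.iff_projective _).2 (P.projective j)
  infer_instance

open Classical in
lemma frac_comm {R : Type u} [CommRing R] (M : Submodule R (Localization (nonZeroDivisors R)))
    (f : M →ₗ[R] R) (x m : M) : f x • m = f m • x := by
  obtain ⟨d, hd⟩ := IsLocalization.exist_integer_multiples_of_finset (nonZeroDivisors R) 
    ({(x : Localization (nonZeroDivisors R)), (m : Localization (nonZeroDivisors R))} : Finset _)
  obtain ⟨a, ha⟩ := hd x (by simp)
  obtain ⟨b, hb⟩ := hd m (by simp)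
  have h1 : b • x = a • m := by
    ext
    have hu := IsLocalization.map_units (Localization (nonZeroDivisors R)) d
    simp only [Submodule.coe_smul, Algebra.smul_def] at *
    rw [ha, hb]; ring
  have h2 : b * f x = a * f m := by simpa using congrArg f h1
  ext
  have hu := IsLocalization.map_units (Localization (nonZeroDivisors R)) d
  apply hu.mul_left_cancel
  have h3 := congrArg (algebraMap R (Localization (nonZeroDivisors R))) h2
  simp only [Submodule.coe_smul, Algebra.smul_def, map_mul] at *
  rw [ha, hb] at h3
  linear_combination h3

lemma exact_R {R : Type u} [CommRing R] {A B C : Type u} [AddCommGroup A] [Module R A]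
    [AddCommGroup B] [Module R B] [AddCommGroup C] [Module R C] (f : A →ₗ[R] B) (g : B →ₗ[R] C)
    (h : Function.Exact f g) : Function.Exact (f.lTensor R) (g.lTensor R) :=
  Module.Flat.lTensor_exact R h

lemma dir1 {R : Type u} [CommRing R] (M : Submodule R (Localization (nonZeroDivisors R)))
    (f : M →ₗ[R] R) (m : M) {A B C : Type u} [AddCommGroup A] [Module R A]
    [AddCommGroup B] [Module R B] [AddCommGroup C] [Module R C] (d : A →ₗ[R] B) (d' : B →ₗ[R] C)
    (h : Function.Exact d d') (x : M ⊗[R] B) (hx : d'.lTensor M x = 0) :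
    ∃ y, d.lTensor M y = f m • x := by
  have h1 : d'.lTensor R (f.rTensor B x) = 0 := by
    have := LinearMap.congr_fun (LinearMap.lTensor_comp_rTensor M f d') x
    have h2 := LinearMap.congr_fun (LinearMap.rTensor_comp_lTensor M f d') x
    simp only [LinearMap.comp_apply] at this h2
    rw [this, ← h2, hx, map_zero]
  obtain ⟨y, hy⟩ := (exact_R d d' h _).1 h1
  refine ⟨(LinearMap.toSpanSingleton R M m).rTensor A y, ?_⟩
  have h3 := LinearMap.congr_fun (LinearMap.lTensor_comp_rTensor _ (LinearMap.toSpanSingleton R M m) d) y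
  have h4 := LinearMap.congr_fun (LinearMap.rTensor_comp_lTensor _ (LinearMap.toSpanSingleton R M m) d) y
  simp only [LinearMap.comp_apply] at h3 h4
  rw [h3, ← h4, hy]
  rw [← LinearMap.comp_apply, ← LinearMap.rTensor_comp]
  have : (LinearMap.toSpanSingleton R M m) ∘ₗ f = f m • LinearMap.id := by
    ext1 z
    simpa using frac_comm M f z m
  rw [this, LinearMap.rTensor_smul]; simp

lemma chase {R : Type u} [CommRing R] {K F M P2 P1 P0 N : Type u}
    [AddCommGroup K] [Module R K] [AddCommGroup F] [Module R F] [AddCommGroup M] [Module R M]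
    [AddCommGroup P2] [Module R P2] [AddCommGroup P1] [Module R P1] [AddCommGroup P0] [Module R P0]
    [AddCommGroup N] [Module R N] [Module.Flat R P0]
    (i : K →ₗ[R] F) (p : F →ₗ[R] M) (hi : Function.Injective i) (hip : Function.Exact i p)
    (hp : Function.Surjective p) (d2 : P2 →ₗ[R] P1) (d1 : P1 →ₗ[R] P0) (q : P0 →ₗ[R] N)
    (h21 : d1 ∘ₗ d2 = 0) (h1 : Function.Exact d1 q) (hq : Function.Surjective q) (r : R)
    (hr : ∀ x : M ⊗[R] P1, d1.lTensor M x = 0 → ∃ y, d2.lTensor M y = r • x)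
    (t : K ⊗[R] N) (ht : i.rTensor N t = 0) : r • t = 0 := by
  have comm : ∀ {X Y A B : Type u} [AddCommGroup X] [Module R X] [AddCommGroup Y] [Module R Y]
    [AddCommGroup A] [Module R A] [AddCommGroup B] [Module R B] (f : X →ₗ[R] Y) (g : A →ₗ[R] B)
    (z : X ⊗[R] A), g.lTensor Y (f.rTensor A z) = f.rTensor B (g.lTensor X z) := by
    intro X Y A B _ _ _ _ _ _ _ _ f g z
    rw [← LinearMap.comp_apply, ← LinearMap.comp_apply, LinearMap.lTensor_comp_rTensor,
      LinearMap.rTensor_comp_lTensor]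
  obtain ⟨t', rfl⟩ := LinearMap.lTensor_surjective K hq t
  rw [← comm] at ht
  obtain ⟨s, hs⟩ := (lTensor_exact F h1 hq _).1 ht
  have hs' : d1.lTensor M (p.rTensor P1 s) = 0 := by
    rw [comm, hs]
    exact (rTensor_exact P0 hip hp _).2 ⟨_, rfl⟩
  obtain ⟨w', hw⟩ := hr _ hs'
  obtain ⟨w, rfl⟩ := LinearMap.rTensor_surjective P2 hp w'
  have h5 : p.rTensor P1 (r • s - d2.lTensor F w) = 0 := by
    rw [map_sub, ← comm, hw, map_smul, sub_self]
  obtain ⟨u, hu⟩ := (rTensor_exact P1 hip hp _).1 h5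
  have h6 : d1.lTensor K u = r • t' := by
    apply Module.Flat.rTensor_preserves_injective_linearMap (M := P0) i hi
    rw [← comm, hu, map_sub, map_smul, hs, map_smul, ← LinearMap.comp_apply,
      ← LinearMap.lTensor_comp, h21]
    simp
  rw [← map_smul, ← h6]
  exact (lTensor_exact K h1 hq _).2 ⟨_, rfl⟩

lemma char_sum {K : Type u} [AddCommGroup K] {ι : Type*} (s : Finset ι)
    (c : ι → CharacterModule K) (x : K) : (∑ j ∈ s, c j) x = ∑ j ∈ s, c j x :=
  AddMonoidHom.finsetSum_apply c s x

/-- if `r` kills the kernel of `K ⊗ N → F ⊗ N` for `N` the character module of `K`, then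
`r • id` on `K` extends to `F`. -/
lemma extend {R : Type u} [CommRing R] {K : Type u} [AddCommGroup K] [Module R K] {n : ℕ}
    [Module.Finite R K] (i : K →ₗ[R] (Fin n → R)) (r : R)
    (hr : ∀ t : K ⊗[R] CharacterModule K, i.rTensor _ t = 0 → r • t = 0) :
    ∃ g : (Fin n → R) →ₗ[R] K, ∀ x, g (i x) = r • x := by
  obtain ⟨b, k, hk⟩ := Module.Finite.exists_fin (R := R) (M := K)
  let L := LinearMap.range (LinearMap.lcomp R K i)
  suffices h : r • LinearMap.id ∈ L by
    obtain ⟨g, hg⟩ := h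
    exact ⟨g, fun x => by simpa using LinearMap.congr_fun hg x⟩
  rw [← Submodule.Quotient.mk_eq_zero]
  apply CharacterModule.eq_zero_of_character_apply
  intro c
  let χ : CharacterModule (K →ₗ[R] K) := CharacterModule.dual L.mkQ c
  let ε : (K →ₗ[R] K) →ₗ[R] (Fin b → K) := LinearMap.pi fun j => LinearMap.applyₗ (k j)
  have hε : Function.Injective ε := by
    intro f g hfg
    apply LinearMap.ext_on hk
    rintro _ ⟨j, rfl⟩
    exact congrFun hfg j
  obtain ⟨φ, hφ⟩ := CharacterModule.dual_surjective_of_injective ε hε χ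
  let φj : Fin b → CharacterModule K := fun j => CharacterModule.dual (LinearMap.single R (fun _ => K) j) φ
  have hχ : ∀ g : K →ₗ[R] K, χ g = ∑ j, φj j (g (k j)) := by
    intro g
    rw [← hφ, CharacterModule.dual_apply]
    change φ (ε g) = ∑ j, φ (Pi.single j (g (k j)))
    rw [← map_sum]
    congr 1
    exact (Finset.univ_sum_single (ε g)).symm
  let t : K ⊗[R] CharacterModule K := ∑ j, k j ⊗ₜ φj j
  have ht : i.rTensor _ t = 0 := by
    apply (TensorProduct.piScalarRight R R (CharacterModule K) (Fin n)).injective.comp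
      (TensorProduct.comm R _ _).injective
    rw [Function.comp_apply]
    ext l x
    have : χ (LinearMap.toSpanSingleton R K x ∘ₗ LinearMap.proj l ∘ₗ i) = 0 := by
      change c (L.mkQ _) = 0
      refine (congrArg c ((Submodule.Quotient.mk_eq_zero L).2 ?_)).trans (map_zero c)
      exact ⟨LinearMap.toSpanSingleton R K x ∘ₗ LinearMap.proj l, rfl⟩
    rw [hχ] at this
    simp only [t, map_sum, LinearMap.rTensor_tmul, TensorProduct.comm_tmul, Function.comp_apply, map_zero, Pi.zero_apply, Finset.sum_apply, char_sum, TensorProduct.piScalarRight_apply, TensorProduct.piScalarRightHom_tmul, CharacterModule.smul_apply]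
    refine Eq.trans ?_ this
    rfl
  have h0 := hr t ht
  have h1 : χ (r • LinearMap.id) = 0 := by
    rw [hχ]
    have h2 := congrArg (fun z => CharacterModule.uncurry (R := R) (A := CharacterModule K) (B := K)
      LinearMap.id (TensorProduct.comm R _ _ z)) h0
    simp only [t, map_smul, map_sum, TensorProduct.comm_tmul, Finset.smul_sum, map_zero,
      TensorProduct.smul_tmul'] at h2
    exact h2
  exact h1

lemma dir2 {R : Type u} [CommRing R] [IsNoetherianRing R]
    (M : Submodule R (Localization (nonZeroDivisors R))) (hfg : M.FG)
    (hreg : ∃ r ∈ nonZeroDivisors R,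
      algebraMap R (Localization (nonZeroDivisors R)) r ∈ M) (r : R)
    (hr : ∀ N : ModuleCat.{u} R, r ∈ Module.annihilator R
          (((Tor (ModuleCat.{u} R) 1).obj (ModuleCat.of R ↥M)).obj N)) : r ∈ traceIdeal R M := by
  have : Module.Finite R M := Module.Finite.iff_fg.2 hfg
  obtain ⟨n, p, hp⟩ := Module.Finite.exists_fin' R M
  have hex : Function.Exact (LinearMap.ker p).subtype p := LinearMap.exact_subtype_ker_map p
  obtain ⟨g, hg⟩ := extend (LinearMap.ker p).subtype r (by
    intro t ht
    let N : ModuleCat.{u} R := ModuleCat.of R (CharacterModule (LinearMap.ker p))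
    let P : ProjectiveResolution N := projectiveResolution N
    have h := (tor_ann (ModuleCat.of R M) N P 0 r).1 (hr N)
    obtain ⟨q, hq, hq'⟩ := res_exact0 P
    have := res_flat P 0
    exact chase (LinearMap.ker p).subtype p Subtype.val_injective hex hp
      (P.complex.d 2 1).hom (P.complex.d 1 0).hom q
      (res_exact P 0).linearMap_comp_eq_zero hq hq' r h t ht)
  let h : (Fin n → R) →ₗ[R] (Fin n → R) := r • LinearMap.id - (LinearMap.ker p).subtype ∘ₗ g
  have hh : ∀ x y, p x = p y → h x = h y := by
    intro x y hxy
    have h1 : p (x - y) = 0 := by rw [map_sub, hxy, sub_self]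
    have h2 := congrArg Subtype.val (hg ⟨x - y, h1⟩)
    rw [← sub_eq_zero, ← map_sub]
    simp only [h, LinearMap.sub_apply, LinearMap.smul_apply, LinearMap.id_apply, LinearMap.comp_apply]
    rw [sub_eq_zero]
    exact h2.symm
  have hph : ∀ x, p (h x) = r • p x := by
    intro x
    simp [h]
  choose σ hσ using hp
  let hb : M →ₗ[R] (Fin n → R) :=
    { toFun := fun x => h (σ x)
      map_add' := fun x y => by
        rw [← map_add]; apply hh; simp [hσ]
      map_smul' := fun a x => by
        rw [RingHom.id_apply, ← map_smul]; apply hh; simp [hσ] }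
  have hphb : ∀ x, p (hb x) = r • x := fun x => by
    change p (h (σ x)) = _
    rw [hph, hσ]
  let f : Fin n → (M →ₗ[R] R) := fun l => LinearMap.proj l ∘ₗ hb
  let m : Fin n → M := fun l => p (Pi.single l 1)
  have key : ∀ x : M, r • x = (∑ l, f l (m l)) • x := by
    intro x
    rw [← hphb, Finset.sum_smul, pi_eq_sum_univ' (hb x), map_sum]
    refine Finset.sum_congr rfl fun l _ => ?_
    rw [map_smul]
    refine Eq.trans ?_ (frac_comm M (f l) x (m l))
    congr 2
  obtain ⟨s, hs, hsM⟩ := hreg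
  have h3 := congrArg Subtype.val (key ⟨_, hsM⟩)
  simp only [Submodule.coe_smul, Algebra.smul_def, ← map_mul] at h3
  have h4 := IsLocalization.injective (Localization (nonZeroDivisors R)) le_rfl h3
  have h5 : r = ∑ l, f l (m l) := (mul_cancel_right_mem_nonZeroDivisors hs).1 h4
  rw [h5]
  exact Submodule.sum_mem _ fun l _ => Submodule.mem_iSup_of_mem (f l) ⟨_, rfl⟩

/-- Let `R` be a commutative Noetherian ring and `M` a finitely generated `R`-submodule of the
total ring of fractions `Q(R)` containing the image of a non-zero-divisor of `R`.  Then the trace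
ideal of `M` equals the intersection, over all `i ≥ 1` and all `R`-modules `N`, of the
annihilators of `Tor_i^R(M, N)`. -/
theorem trace_eq_iInf_ann_tor (R : Type u) [CommRing R] [IsNoetherianRing R]
    (M : Submodule R (Localization (nonZeroDivisors R)))
    (hfg : M.FG)
    (hreg : ∃ r ∈ nonZeroDivisors R,
      algebraMap R (Localization (nonZeroDivisors R)) r ∈ M) :
    traceIdeal R ↥M =
      ⨅ (i : ℕ) (_ : 1 ≤ i) (N : ModuleCat.{u} R),
        Module.annihilator R
          (((Tor (ModuleCat.{u} R) i).obj (ModuleCat.of R ↥M)).obj N) := by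
  apply le_antisymm
  · refine iSup_le fun f => ?_
    rintro _ ⟨m, rfl⟩
    simp only [Submodule.mem_iInf]
    intro i hi N
    obtain ⟨j, rfl⟩ := Nat.exists_eq_add_of_le' hi
    let P : ProjectiveResolution N := projectiveResolution N
    rw [tor_ann _ N P j]
    intro x hx
    exact dir1 M f m _ _ (res_exact P j) x hx
  · intro r hr
    simp only [Submodule.mem_iInf] at hr
    exact dir2 M hfg hreg r (hr 1 le_rfl)
end

section
/- Let R be a commutative Noetherian ring and M a finitely generated R-module. Then the set {x ∈ R : the multiplication map x·id_M : M → M factors through some finitely generated free R-module} equals the intersection, taken over all integers i ≥ 1 and all (not necessarily finitely generated) R-modules N, of the annihilators ann_R Tor_i^R(M, N). -/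
open CategoryTheory Opposite

universe u

section aux

variable {R : Type u} [CommRing R]

lemma aux_lift {A B C P : Type*} [AddCommGroup A] [AddCommGroup B] [AddCommGroup C]
    [AddCommGroup P] [Module R A] [Module R B] [Module R C] [Module R P] [Module.Projective R P]
    (f : A →ₗ[R] B) (g : B →ₗ[R] C) (hfg : Function.Exact f g) (h : P →ₗ[R] B)
    (hh : g ∘ₗ h = 0) : ∃ k : P →ₗ[R] A, f ∘ₗ k = h := by
  have hr : ∀ p, h p ∈ LinearMap.range f := fun p => by
    have : g (h p) = 0 := LinearMap.congr_fun hh p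
    exact (hfg _).1 this
  obtain ⟨k, hk⟩ := Module.projective_lifting_property f.rangeRestrict (h.codRestrict _ hr)
    f.surjective_rangeRestrict
  refine ⟨k, ?_⟩
  ext p
  exact congrArg Subtype.val (LinearMap.congr_fun hk p)

lemma aux_core {M : Type u} [AddCommGroup M] [Module R M]
    {n m : ℕ} (p : (Fin n → R) →ₗ[R] M) (hp : Function.Surjective p)
    (a : (Fin m → R) →ₗ[R] (Fin n → R)) (hap : Function.Exact a p)
    (T : (Fin n → R) →ₗ[R] (Fin m → R))
    (hT : ∀ v w, T v ⬝ᵥ w = v ⬝ᵥ a w)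
    {N P0 P1 P2 : Type u} [AddCommGroup N] [Module R N]
    [AddCommGroup P0] [Module R P0] [AddCommGroup P1] [Module R P1] [AddCommGroup P2] [Module R P2]
    [Module.Projective R P0] [Module.Projective R P1]
    (q : (Fin m → R) →ₗ[R] N) (hq : Function.Surjective q) (hTq : Function.Exact T q)
    (e : P0 →ₗ[R] N) (he : Function.Surjective e)
    (d1 : P1 →ₗ[R] P0) (d2 : P2 →ₗ[R] P1) (h10 : Function.Exact d1 e)
    (h21 : Function.Exact d2 d1) (x : R)
    (hx : ∀ z : TensorProduct R M P1, d1.lTensor M z = 0 → ∃ w, d2.lTensor M w = x • z) :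
    ∃ (n : ℕ) (g : M →ₗ[R] (Fin n → R)) (f : (Fin n → R) →ₗ[R] M),
        f ∘ₗ g = x • (LinearMap.id : M →ₗ[R] M) := by
  obtain ⟨h0, hh0⟩ := Module.projective_lifting_property e q he
  obtain ⟨h1, hh1⟩ := aux_lift d1 e h10 (h0 ∘ₗ T) (by
    rw [← LinearMap.comp_assoc, hh0, hTq.linearMap_comp_eq_zero])
  obtain ⟨k0, hk0⟩ := Module.projective_lifting_property q e hq
  obtain ⟨k1, hk1⟩ := aux_lift T q hTq (k0 ∘ₗ d1) (by
    rw [← LinearMap.comp_assoc, hk0, h10.linearMap_comp_eq_zero])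
  obtain ⟨s, hs⟩ := aux_lift T q hTq (k0 ∘ₗ h0 - LinearMap.id) (by
    rw [LinearMap.comp_sub, ← LinearMap.comp_assoc, hk0, hh0]; simp)
  -- the fundamental element
  let ζ : TensorProduct R M (Fin n → R) := ∑ i, p (Pi.single i 1) ⊗ₜ Pi.single i 1
  -- evaluation
  let ev : TensorProduct R M (Fin n → R) →ₗ[R] (Fin n → R) →ₗ[R] M :=
    TensorProduct.lift (LinearMap.mk₂ R
      (fun y v => (LinearMap.toSpanSingleton R M y) ∘ₗ (dotProductBilin R R v))
      (by intros; ext; simp) (by intros; ext; simp; rw [smul_comm])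
      (by intros; ext; simp [add_smul])
      (by intros; ext; simp [mul_smul]))
  have ev_tmul : ∀ y v w, ev (y ⊗ₜ v) w = (v ⬝ᵥ w) • y := by
    intro y v w; simp [ev]
  have ev_zeta : ev ζ = p := by
    ext j
    simp only [ζ, map_sum, LinearMap.comp_apply, LinearMap.sum_apply, ev_tmul]
    rw [Finset.sum_eq_single j]
    · simp
    · intro i _ hij
      simp [Pi.single_eq_of_ne hij.symm]
    · simp
  have Tζ : T.lTensor M ζ = 0 := by
    have e1 : ∀ i, T (Pi.single i 1) = ∑ j, (a (Pi.single j 1) i) • Pi.single j (1 : R) := by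
      intro i
      ext j
      have := hT (Pi.single i 1) (Pi.single j 1)
      simp only [dotProduct_single, single_dotProduct, mul_one, one_mul] at this
      rw [this, Finset.sum_apply, Finset.sum_eq_single j]
      · simp
      · intro k _ hk
        simp [Pi.single_eq_of_ne hk.symm]
      · simp
    have e2 : ∀ j, ∑ i, (a (Pi.single j 1) i) • p (Pi.single i 1) = 0 := by
      intro j
      rw [← hap.apply_apply_eq_zero (Pi.single j 1)]
      conv_rhs => rw [pi_eq_sum_univ' (a (Pi.single j 1))]
      rw [map_sum]
      refine Finset.sum_congr rfl fun i _ => ?_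
      rw [← map_smul]
    simp only [ζ, map_sum, LinearMap.lTensor_tmul, e1, TensorProduct.tmul_sum,
      TensorProduct.tmul_smul]
    rw [Finset.sum_comm]
    refine Finset.sum_eq_zero fun j _ => ?_
    simp only [TensorProduct.smul_tmul']
    rw [← TensorProduct.sum_tmul, e2, TensorProduct.zero_tmul]
  -- the maps of the form `M → free → M`
  let good : Submodule R (TensorProduct R M (Fin n → R)) :=
    LinearMap.range ((LinearMap.ker T).subtype.lTensor M)
  have hgood : ∀ {Q : Type u} [AddCommGroup Q] [Module R Q] (c : Q →ₗ[R] (Fin n → R))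
      (hc : T ∘ₗ c = 0) (z : TensorProduct R M Q), c.lTensor M z ∈ good := by
    intro Q _ _ c hc z
    have hc' : ∀ y, c y ∈ LinearMap.ker T := fun y => LinearMap.congr_fun hc y
    refine ⟨(c.codRestrict _ hc').lTensor M z, ?_⟩
    rw [← LinearMap.comp_apply, ← LinearMap.lTensor_comp, LinearMap.subtype_comp_codRestrict]
  have hxζ : x • ζ ∈ good := by
    obtain ⟨w, hw⟩ := hx (h1.lTensor M ζ) (by
      rw [← LinearMap.comp_apply, ← LinearMap.lTensor_comp, hh1, LinearMap.lTensor_comp,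
        LinearMap.comp_apply, Tζ, map_zero])
    have e1 := hgood (k1 ∘ₗ d2) (by
      rw [← LinearMap.comp_assoc, hk1, LinearMap.comp_assoc, h21.linearMap_comp_eq_zero]
      simp) w
    have e2 := hgood (k1 ∘ₗ h1 - LinearMap.id - s ∘ₗ T) (by
      rw [LinearMap.comp_sub, LinearMap.comp_sub, ← LinearMap.comp_assoc, hk1,
        LinearMap.comp_assoc, hh1, ← LinearMap.comp_assoc, ← LinearMap.comp_assoc, hs]
      ext; simp) ζ
    rw [LinearMap.lTensor_comp, LinearMap.comp_apply, hw, map_smul] at e1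
    simp only [LinearMap.lTensor_sub, LinearMap.lTensor_comp, LinearMap.sub_apply,
      LinearMap.comp_apply, Tζ, map_zero, LinearMap.lTensor_id, LinearMap.id_apply, sub_zero] at e2
    have e3 := good.sub_mem e1 (good.smul_mem x e2)
    simpa [smul_sub] using e3
  -- conclude
  have key : ∀ z ∈ good, ∃ (k : ℕ) (g : M →ₗ[R] (Fin k → R)) (f : (Fin k → R) →ₗ[R] M),
      f ∘ₗ g ∘ₗ p = ev z := by
    rintro _ ⟨z, rfl⟩
    obtain ⟨k, y, v, rfl⟩ : ∃ (k : ℕ) (y : Fin k → M) (v : Fin k → LinearMap.ker T),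
        z = ∑ i, y i ⊗ₜ v i := by
      obtain ⟨k, y, v, h⟩ := TensorProduct.exists_sum_tmul_eq z
      exact ⟨k, y, v, h⟩
    have hv : ∀ i, ∃ φ : M →ₗ[R] R, φ ∘ₗ p = dotProductBilin R R (v i : Fin n → R) := by
      intro i
      have hle : LinearMap.ker p ≤ LinearMap.ker (dotProductBilin R R (v i : Fin n → R)) := by
        intro y hy
        obtain ⟨w, rfl⟩ := (hap y).1 hy
        change (v i : Fin n → R) ⬝ᵥ a w = 0
        rw [← hT, (v i).2, zero_dotProduct]
      refine ⟨(LinearMap.ker p).liftQ _ hle ∘ₗ (p.quotKerEquivOfSurjective hp).symm.toLinearMap, ?_⟩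
      refine LinearMap.ext fun y => ?_
      have : (p.quotKerEquivOfSurjective hp).symm (p y) = Submodule.Quotient.mk y := by
        rw [LinearEquiv.symm_apply_eq]; rfl
      rw [LinearMap.comp_apply, LinearMap.comp_apply, LinearEquiv.coe_coe, this]
      rfl
    choose φ hφ using hv
    refine ⟨k, LinearMap.pi φ, Fintype.linearCombination R y, ?_⟩
    ext j
    have : ∀ i, φ i (p (Pi.single j 1)) = (v i : Fin n → R) ⬝ᵥ (Pi.single j 1) := fun i => by
      rw [← LinearMap.comp_apply, hφ]; rfl
    simp [Fintype.linearCombination_apply, map_sum, ev_tmul, this]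
  obtain ⟨k, g, f, hgf⟩ := key _ hxζ
  refine ⟨k, g, f, ?_⟩
  rw [map_smul, ev_zeta] at hgf
  ext y
  obtain ⟨v, rfl⟩ := hp y
  simpa using LinearMap.congr_fun hgf v

lemma aux_tor (M N : ModuleCat.{u} R) (P : ProjectiveResolution N) (i : ℕ) (x : R) :
    x ∈ Module.annihilator R (((Tor (ModuleCat.{u} R) (i+1)).obj M).obj N) ↔
    ∀ z : TensorProduct R M (P.complex.X (i+1)), (P.complex.d (i+1) i).hom.lTensor M z = 0 →
      ∃ w, (P.complex.d (i+2) (i+1)).hom.lTensor M w = x • z := by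
  let F := (MonoidalCategory.tensoringLeft (ModuleCat.{u} R)).obj M
  let K := (F.mapHomologicalComplex (ComplexShape.down ℕ)).obj P.complex
  let S := K.sc' (i+2) (i+1) i
  let iso : ((Tor (ModuleCat.{u} R) (i+1)).obj M).obj N ≅ S.moduleCatLeftHomologyData.H :=
    P.isoLeftDerivedObj F (i+1) ≪≫
      ShortComplex.homologyMapIso (K.isoSc' (i+2) (i+1) i (by simp) (by simp)) ≪≫
      S.moduleCatHomologyIso
  rw [iso.toLinearEquiv.annihilator_eq]
  change x ∈ Module.annihilator R (LinearMap.ker S.g.hom ⧸ LinearMap.range S.moduleCatToCycles) ↔ _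
  rw [Module.mem_annihilator]
  constructor
  · intro h z hz
    have := h (Submodule.Quotient.mk ⟨z, hz⟩)
    rw [← Submodule.Quotient.mk_smul, Submodule.Quotient.mk_eq_zero] at this
    obtain ⟨w, hw⟩ := this
    exact ⟨w, congrArg Subtype.val hw⟩
  · intro h m
    obtain ⟨⟨z, hz⟩, rfl⟩ := Submodule.Quotient.mk_surjective _ m
    rw [← Submodule.Quotient.mk_smul, Submodule.Quotient.mk_eq_zero]
    obtain ⟨w, hw⟩ := h z hz
    exact ⟨w, Subtype.ext hw⟩

end aux

/-- Let `R` be a commutative Noetherian ring and `M` a finitely generated `R`-module.  Then an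
element `x ∈ R` is such that multiplication by `x` on `M` factors through a finitely generated
free `R`-module if and only if `x` lies in the intersection, over all `i ≥ 1` and all `R`-modules
`N`, of the annihilators of `Tor_i^R(M, N)`. -/
theorem factoring_set_eq_iInf_ann_tor (R : Type u) [CommRing R] [IsNoetherianRing R]
    (M : Type u) [AddCommGroup M] [Module R M] [Module.Finite R M] :
    ∀ x : R,
      (∃ (n : ℕ) (g : M →ₗ[R] (Fin n → R)) (f : (Fin n → R) →ₗ[R] M),
        f ∘ₗ g = x • (LinearMap.id : M →ₗ[R] M)) ↔
      x ∈ ⨅ (i : ℕ) (_ : 1 ≤ i) (N : ModuleCat.{u} R),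
        Module.annihilator R
          (((Tor (ModuleCat.{u} R) i).obj (ModuleCat.of R M)).obj N) := by
  intro x
  simp only [Submodule.mem_iInf]
  constructor
  · rintro ⟨n, g, f, hfg⟩ i hi N
    obtain ⟨i, rfl⟩ : ∃ j, i = j + 1 := ⟨i - 1, by omega⟩
    let P := projectiveResolution N
    rw [aux_tor _ _ P]
    intro z hz
    have hex : Function.Exact (P.complex.d (i+2) (i+1)).hom (P.complex.d (i+1) i).hom :=
      (ShortComplex.ShortExact.moduleCat_exact_iff_function_exact _).1 (P.exact_succ i)
    have hex' := Module.Flat.lTensor_exact (Fin n → R) hex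
    obtain ⟨w, hw⟩ := (hex' (g.rTensor _ z)).1 (by
      rw [← LinearMap.comp_apply, LinearMap.lTensor_comp_rTensor,
        ← LinearMap.rTensor_comp_lTensor, LinearMap.comp_apply]
      erw [hz]
      rw [map_zero])
    refine ⟨f.rTensor _ w, ?_⟩
    have : x • z = f.rTensor _ (g.rTensor _ z) := by
      rw [← LinearMap.comp_apply, ← LinearMap.rTensor_comp, hfg, LinearMap.rTensor_smul]
      simp
    rw [this, ← hw]
    rw [← LinearMap.comp_apply, ← LinearMap.comp_apply]
    erw [LinearMap.lTensor_comp_rTensor, LinearMap.rTensor_comp_lTensor]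
  · intro h
    obtain ⟨n, p, hp⟩ := Module.Finite.exists_fin' R M
    obtain ⟨m, a', ha'⟩ := Module.Finite.exists_fin' R (LinearMap.ker p)
    let a := (LinearMap.ker p).subtype ∘ₗ a'
    let T : (Fin n → R) →ₗ[R] (Fin m → R) := (LinearMap.toMatrix' a).vecMulLinear
    let N := ModuleCat.of R ((Fin m → R) ⧸ LinearMap.range T)
    let P := projectiveResolution N
    have hx := (aux_tor _ _ P 0 x).1 (h 1 le_rfl N)
    have hP : ∀ n, Module.Projective R (P.complex.X n) := fun n =>
      (IsProjective.iff_projective _).2 (P.projective n)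
    refine aux_core p hp a ?_ T ?_ (N := N) (LinearMap.range T).mkQ
      (Submodule.mkQ_surjective _) ?_ (P.π.f 0).hom ?_ (P.complex.d 1 0).hom
      (P.complex.d 2 1).hom ?_ ?_ x hx
    · rw [LinearMap.exact_iff, LinearMap.range_comp, LinearMap.range_eq_top.2 ha']
      simp
    · intro v w
      simp only [T, Matrix.vecMulLinear_apply]
      rw [← Matrix.dotProduct_mulVec, LinearMap.toMatrix'_mulVec]
    · exact LinearMap.exact_map_mkQ_range T
    · exact (ModuleCat.epi_iff_surjective _).1 inferInstance
    · exact (ShortComplex.ShortExact.moduleCat_exact_iff_function_exact _).1 P.exact₀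
    · exact (ShortComplex.ShortExact.moduleCat_exact_iff_function_exact _).1 (P.exact_succ 0)
end

section
/- Let (R, 𝔪) be a one-dimensional Noetherian local ring whose 𝔪-adic completion R̂ is reduced. Then the extension of the conductor of R to R̂ is contained in the conductor of R̂: the ideal 𝒞(R)·R̂ of R̂ is contained in 𝒞(R̂), where 𝒞(R̂) denotes the conductor of R̂ in the integral closure of R̂ in its total ring of fractions. -/
universe u

/-- The conductor of a commutative ring `S` in the integral closure `S̄` of `S` inside its total
ring of fractions `Q(S)`: the ideal `(S : S̄) = {q ∈ Q(S) : q·S̄ ⊆ S}` of `S`. -/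
noncomputable def conductorIdeal (S : Type u) [CommRing S] : Ideal S :=
  Submodule.comap (Algebra.linearMap S (Localization (nonZeroDivisors S)))
    ((1 : Submodule S (Localization (nonZeroDivisors S))) /
      (Subalgebra.toSubmodule (integralClosure S (Localization (nonZeroDivisors S)))))

open IsLocalRing

lemma isPrecomplete_fin {A : Type*} [CommRing A] (I : Ideal A) [IsPrecomplete I A] (n : ℕ) :
    IsPrecomplete I (Fin n → A) := by
  rw [← AdicCompletion.of_surjective_iff]
  intro y
  choose x hx using fun j => AdicCompletion.of_surjective I A (AdicCompletion.piEquivFin I n y j)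
  refine ⟨x, (AdicCompletion.piEquivFin I n).injective ?_⟩
  funext j
  rw [← hx j, AdicCompletion.piEquivFin_apply]
  exact AdicCompletion.map_of I _ x

lemma noeth_of_complete {A : Type*} [CommRing A] (I : Ideal A) [IsAdicComplete I A]
    (t : A) (ht : t ∈ I) (hN : IsNoetherian A (A ⧸ Ideal.span {t})) : IsNoetherianRing A := by
  refine IsNoetherianRing.of_prime fun p hp => ?_
  have hfg : (Submodule.map (Ideal.span {t}).mkQ p).FG := IsNoetherian.noetherian _
  by_cases htp : t ∈ p
  · refine Submodule.fg_of_fg_map_of_fg_inf_ker (Ideal.span {t}).mkQ hfg ?_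
    rw [Submodule.ker_mkQ, inf_eq_right.mpr (by simpa [Ideal.span_le] using htp)]
    exact ⟨{t}, by simp⟩
  · set N := Submodule.map (Ideal.span {t}).mkQ p with hNdef
    have : Module.Finite A N := Module.Finite.iff_fg.mpr hfg
    obtain ⟨n, f, hf⟩ := Module.Finite.exists_fin' A N
    let g : p →ₗ[A] N := (Ideal.span {t}).mkQ.submoduleMap p
    have hg : Function.Surjective g := LinearMap.submoduleMap_surjective _ _
    obtain ⟨h, hh⟩ := Module.projective_lifting_property g f hg
    have := isPrecomplete_fin I n
    have : IsHausdorff I p := by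
      refine ⟨fun x hx => Subtype.ext ?_⟩
      refine IsHausdorff.haus (I := I) inferInstance (x : A) fun k => ?_
      have := hx k
      rw [SModEq.zero] at this ⊢
      have h2 := Submodule.mem_map_of_mem (f := p.subtype) this
      rw [Submodule.map_smul''] at h2
      exact Submodule.smul_mono le_rfl le_top h2
    have hs : Function.Surjective h := by
      refine surjective_of_mkQ_comp_surjective (I := I) fun y => ?_
      obtain ⟨y, rfl⟩ := Submodule.mkQ_surjective _ y
      obtain ⟨v, hv⟩ := hf (g y)
      refine ⟨v, ?_⟩
      have h1 : g (h v) = g y := by rw [← hv, ← hh]; rfl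
      have h2 : ((h v - y : p) : A) ∈ Ideal.span {t} := by
        have := congrArg Subtype.val h1
        exact (Submodule.Quotient.eq _).mp this
      obtain ⟨z, hz⟩ := Ideal.mem_span_singleton.mp h2
      have hzp : z ∈ p := (hp.mem_or_mem (hz ▸ (h v - y).2)).resolve_left htp
      refine (Submodule.Quotient.eq _).mpr ?_
      have : h v - y = t • (⟨z, hzp⟩ : p) := Subtype.ext hz
      rw [this]
      exact Submodule.smul_mem_smul ht trivial
    refine Module.Finite.iff_fg.mp ?_
    exact Module.Finite.of_surjective h hs

lemma max_le_radical {A : Type*} [CommRing A] [IsLocalRing A] {J : Ideal A}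
    (h : maximalIdeal A ∈ J.minimalPrimes) : maximalIdeal A ≤ J.radical := by
  rw [Ideal.radical_eq_sInf]
  refine le_sInf fun q hq => ?_
  exact h.2 ⟨hq.2, hq.1⟩ (le_maximalIdeal hq.2.ne_top)

lemma exists_pow_max_le {A : Type*} [CommRing A] [IsLocalRing A] [IsNoetherianRing A]
    {t : A} {N : ℕ} (htm : t ∈ maximalIdeal A) (hN : maximalIdeal A ^ N ≤ Ideal.span {t}) {b : A}
    (hb : b ∈ nonZeroDivisors A) (hu : ¬ IsUnit b) : ∃ n, t ^ n ∈ Ideal.span {b} := by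
  have h1 : maximalIdeal A ∈ (Ideal.span {t}).minimalPrimes := by
    refine ⟨⟨inferInstance, by simpa [Ideal.span_le] using htm⟩, fun q hq _ => ?_⟩
    exact hq.1.le_of_pow_le (hN.trans hq.2)
  have h2 := Ideal.height_le_one_of_isPrincipal_of_mem_minimalPrimes _ _ h1
  have h3 := Ideal.height_span_singleton_eq_one_of_mem_nonZeroDivisors hb hu
  have h4 : maximalIdeal A ∈ (Ideal.span {b}).minimalPrimes := by
    refine Ideal.mem_minimalPrimes_of_height_le ?_ (h2.trans h3.ge)
    rw [Ideal.span_singleton_le_iff_mem]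
    exact hu
  exact max_le_radical h4 htm

lemma exists_param {R : Type*} [CommRing R] [IsNoetherianRing R]
    [IsLocalRing R] (hdim : ringKrullDim R = 1) :
    ∃ t ∈ maximalIdeal R, ∃ N, maximalIdeal R ^ N ≤ Ideal.span {t} := by
  obtain ⟨s, hs, hc⟩ := (maximalIdeal R).exists_finset_card_eq_height_of_isNoetherianRing
  have : (maximalIdeal R).height = 1 := by
    have := maximalIdeal_height_eq_ringKrullDim (R := R)
    rw [hdim] at this
    exact_mod_cast this
  rw [this] at hc
  obtain ⟨t, rfl⟩ := Finset.card_eq_one.mp (by exact_mod_cast hc : s.card = 1)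
  rw [Finset.coe_singleton] at hs
  refine ⟨t, hs.1.2 (Ideal.mem_span_singleton_self t), ?_⟩
  exact Ideal.exists_pow_le_of_le_radical_of_fg (max_le_radical hs) (IsNoetherian.noetherian _)

lemma integral_descent {R A : Type*} [CommRing R] [CommRing A] [Algebra R A] [Nontrivial A]
    (m : Ideal R)
    (h1 : ∀ n (a : A), ∃ r : R, a - algebraMap R A r ∈ (m ^ n).map (algebraMap R A))
    (h2 : ∀ n (r : R), algebraMap R A r ∈ (m ^ n).map (algebraMap R A) → r ∈ m ^ n)
    (r s : R) (hs : ∃ n, m ^ n ≤ Ideal.span {s})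
    (p : Polynomial A) (hp : p.Monic)
    (hpe : (p.scaleRoots (algebraMap R A s)).eval (algebraMap R A r) = 0)
    (K : Type*) [CommRing K] [Algebra R K] (z : K)
    (hsK : IsUnit (algebraMap R K s))
    (hz : algebraMap R K s * z = algebraMap R K r) : IsIntegral R z := by
  set k := p.natDegree with hk
  have hk0 : k ≠ 0 := by
    intro h0
    have : p = 1 := by exact hp.natDegree_eq_zero.mp h0
    rw [this] at hpe
    simp at hpe
  obtain ⟨n, hn⟩ := hs
  have hM : m ^ (n * k) ≤ Ideal.span {s ^ k} := by
    rw [pow_mul, ← Ideal.span_singleton_pow]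
    exact Ideal.pow_right_mono hn k
  choose g hg using fun i => h1 (n * k) (p.coeff i)
  rw [Polynomial.eval_eq_sum_range, Polynomial.natDegree_scaleRoots, ← hk,
    Finset.sum_range_succ] at hpe
  simp only [Polynomial.coeff_scaleRoots, ← hk] at hpe
  rw [show p.coeff k = 1 from hp, Nat.sub_self, pow_zero, one_mul, one_mul] at hpe
  have hw : r ^ k + ∑ i ∈ Finset.range k, g i * s ^ (k - i) * r ^ i ∈ m ^ (n * k) := by
    apply h2
    have : algebraMap R A (r ^ k + ∑ i ∈ Finset.range k, g i * s ^ (k - i) * r ^ i) =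
        - ∑ i ∈ Finset.range k, (p.coeff i - algebraMap R A (g i)) *
          (algebraMap R A s ^ (k - i) * algebraMap R A r ^ i) := by
      simp only [map_add, map_sum, map_mul, map_pow, sub_mul, Finset.sum_sub_distrib]
      simp only [← mul_assoc]
      linear_combination hpe
    rw [this]
    exact neg_mem (sum_mem fun i _ => Ideal.mul_mem_right _ _ (hg i))
  obtain ⟨v, hv⟩ := Ideal.mem_span_singleton.mp (hM hw)
  refine ⟨Polynomial.X ^ k + (∑ i ∈ Finset.range k, Polynomial.C (g i) * Polynomial.X ^ i
    - Polynomial.C v), ?_, ?_⟩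
  · apply Polynomial.monic_X_pow_add
    refine (Polynomial.degree_sub_le _ _).trans_lt (max_lt ?_ ?_)
    · rw [← Fin.sum_univ_eq_sum_range (fun i => Polynomial.C (g i) * Polynomial.X ^ i)]
      exact Polynomial.degree_sum_fin_lt _
    · exact Polynomial.degree_C_le.trans_lt (by exact_mod_cast Nat.pos_of_ne_zero hk0)
  · have hv' := congrArg (algebraMap R K) hv
    simp only [map_add, map_sum, map_mul, map_pow, ← hz] at hv'
    simp only [Polynomial.eval₂_add, Polynomial.eval₂_sub, Polynomial.eval₂_finsetSum,
      Polynomial.eval₂_mul, Polynomial.eval₂_C, Polynomial.eval₂_X_pow]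
    refine (hsK.pow k).mul_left_cancel ?_
    have : ∑ i ∈ Finset.range k, algebraMap R K (g i) * algebraMap R K s ^ (k - i) *
        (algebraMap R K s * z) ^ i =
        algebraMap R K s ^ k * ∑ i ∈ Finset.range k, algebraMap R K (g i) * z ^ i := by
      rw [Finset.mul_sum]
      refine Finset.sum_congr rfl fun i hi => ?_
      have : algebraMap R K s ^ k = algebraMap R K s ^ (k - i) * algebraMap R K s ^ i := by
        rw [← pow_add, Nat.sub_add_cancel (Finset.mem_range.mp hi).le]
      rw [this]; ring
    rw [this] at hv'
    linear_combination hv'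

lemma mem_map_pow_iff {R : Type*} [CommRing R] (I : Ideal R) (hI : I.FG) (n : ℕ)
    (a : AdicCompletion I R) :
    a ∈ (I ^ n).map (algebraMap R (AdicCompletion I R)) ↔ AdicCompletion.eval I R n a = 0 := by
  rw [← LinearMap.mem_ker, ← AdicCompletion.pow_smul_top_eq_ker_eval hI, Ideal.smul_top_eq_map]
  rfl

lemma comp_h1 {R : Type*} [CommRing R] (I : Ideal R) (hI : I.FG) (n : ℕ)
    (a : AdicCompletion I R) : ∃ r : R, a - algebraMap R (AdicCompletion I R) r ∈
      (I ^ n).map (algebraMap R (AdicCompletion I R)) := by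
  obtain ⟨r, hr⟩ := Submodule.mkQ_surjective _ (AdicCompletion.eval I R n a)
  refine ⟨r, ?_⟩
  rw [mem_map_pow_iff I hI, map_sub, ← hr, sub_eq_zero]
  rfl

lemma comp_h2 {R : Type*} [CommRing R] (I : Ideal R) (hI : I.FG) (n : ℕ)
    (r : R) (h : algebraMap R (AdicCompletion I R) r ∈
      (I ^ n).map (algebraMap R (AdicCompletion I R))) : r ∈ I ^ n := by
  rw [mem_map_pow_iff I hI] at h
  have h' : (Submodule.Quotient.mk r : R ⧸ (I ^ n • ⊤ : Submodule R R)) = 0 := h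
  rw [Submodule.Quotient.mk_eq_zero] at h'
  simpa using h'

lemma mem_conductorIdeal {S : Type u} [CommRing S] (c : S) :
    c ∈ conductorIdeal S ↔ ∀ x : Localization (nonZeroDivisors S), IsIntegral S x →
      ∃ y : S, algebraMap S _ y = algebraMap S _ c * x := by
  unfold conductorIdeal
  rw [Submodule.mem_comap, Submodule.mem_div_iff_forall_mul_mem]
  simp only [Submodule.mem_one]
  rfl

lemma core_conductor {R A : Type u} [CommRing R] [IsNoetherianRing R] [IsLocalRing R]
    (hdim : ringKrullDim R = 1) [CommRing A] [IsLocalRing A] [Algebra R A]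
    (h1 : ∀ n (a : A), ∃ r : R, a - algebraMap R A r ∈
      ((maximalIdeal R) ^ n).map (algebraMap R A))
    (h2 : ∀ n (r : R), algebraMap R A r ∈ ((maximalIdeal R) ^ n).map (algebraMap R A) →
      r ∈ (maximalIdeal R) ^ n)
    (hmax : maximalIdeal A = (maximalIdeal R).map (algebraMap R A))
    (hinj : Function.Injective (algebraMap R A))
    (hcomp : IsAdicComplete (maximalIdeal A) A) :
    Ideal.map (algebraMap R A) (conductorIdeal R) ≤ conductorIdeal A := by
  obtain ⟨t, htm, N, hN⟩ := exists_param hdim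
  have htA : algebraMap R A t ∈ maximalIdeal A := hmax ▸ Ideal.mem_map_of_mem _ htm
  have hNA : maximalIdeal A ^ N ≤ Ideal.span {algebraMap R A t} := by
    rw [hmax, ← Ideal.map_pow, ← Set.image_singleton, ← Ideal.map_span]
    exact Ideal.map_mono hN
  have hnoeth : IsNoetherianRing A := by
    refine noeth_of_complete (maximalIdeal A) _ htA ?_
    have : IsNoetherian R (A ⧸ Ideal.span {algebraMap R A t}) := by
      refine isNoetherian_of_surjective
        (Algebra.linearMap R (A ⧸ Ideal.span {algebraMap R A t}))
        (LinearMap.range_eq_top.mpr fun y => ?_)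
      obtain ⟨a, rfl⟩ := Ideal.Quotient.mk_surjective y
      obtain ⟨r, hr⟩ := h1 N a
      rw [Ideal.map_pow, ← hmax] at hr
      exact ⟨r, ((Ideal.Quotient.mk_eq_mk_iff_sub_mem _ _).mpr (hNA hr)).symm⟩
    exact isNoetherian_of_tower R this
  rw [Ideal.map_le_iff_le_comap]
  intro c hc
  rw [mem_conductorIdeal] at hc
  rw [Ideal.mem_comap, mem_conductorIdeal]
  set L := Localization (nonZeroDivisors A)
  set K := Localization (nonZeroDivisors R)
  intro x hx
  obtain ⟨⟨a, b⟩, hab⟩ := IsLocalization.surj (nonZeroDivisors A) x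
  simp only at hab
  by_cases hu : IsUnit (b : A)
  · obtain ⟨b', hb'⟩ := hu.exists_left_inv
    refine ⟨algebraMap R A c * (a * b'), ?_⟩
    rw [map_mul, map_mul, ← hab]
    have := congrArg (algebraMap A L) hb'
    rw [map_mul, map_one] at this
    linear_combination (algebraMap A L (algebraMap R A c)) * x * this
  obtain ⟨n, hn⟩ := exists_pow_max_le htA hNA b.2 hu
  obtain ⟨d, hd⟩ := Ideal.mem_span_singleton.mp hn
  have htreg : algebraMap R A t ∈ nonZeroDivisors A := by
    have : (b : A) ^ N ∈ Ideal.span {algebraMap R A t} :=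
      hNA (Ideal.pow_mem_pow (by exact hu) N)
    obtain ⟨e, he⟩ := Ideal.mem_span_singleton.mp this
    have hbN : (b : A) ^ N ∈ nonZeroDivisors A := pow_mem b.2 N
    rw [he] at hbN
    exact (mul_mem_nonZeroDivisors.mp hbN).1
  set s : R := t ^ n with hs
  have hsA : algebraMap R A s ∈ nonZeroDivisors A := by
    rw [hs, map_pow]; exact pow_mem htreg n
  have hsR : s ∈ nonZeroDivisors R := mem_nonZeroDivisors_of_injective hinj hsA
  have hsM : maximalIdeal R ^ (N * n) ≤ Ideal.span {s} := by
    rw [pow_mul, hs, ← Ideal.span_singleton_pow]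
    exact Ideal.pow_right_mono hN n
  obtain ⟨r, hr⟩ := h1 (N * n) (a * d)
  have hr' : a * d - algebraMap R A r ∈ Ideal.span {algebraMap R A s} := by
    rw [← Set.image_singleton, ← Ideal.map_span]
    exact Ideal.map_mono hsM hr
  obtain ⟨e, he⟩ := Ideal.mem_span_singleton.mp hr'
  have hsL : IsUnit (algebraMap A L (algebraMap R A s)) :=
    IsLocalization.map_units L ⟨_, hsA⟩
  have hsK : IsUnit (algebraMap R K s) := IsLocalization.map_units K ⟨_, hsR⟩
  have hLinj : Function.Injective (algebraMap A L) := IsLocalization.injective L le_rfl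
  have hKinj : Function.Injective (algebraMap R K) := IsLocalization.injective K le_rfl
  have hy : algebraMap A L (algebraMap R A s) * (x - algebraMap A L e) =
      algebraMap A L (algebraMap R A r) := by
    have e1 := congrArg (algebraMap A L) he
    have e2 := congrArg (algebraMap A L) hd
    simp only [map_sub, map_mul, map_pow] at e1 e2
    simp only [hs, map_pow] at e1 ⊢
    linear_combination e1 + x * e2 + algebraMap A L d * hab
  obtain ⟨p, hp, hpx⟩ := hx.sub (isIntegral_algebraMap (x := e))
  have hpe : (p.scaleRoots (algebraMap R A s)).eval (algebraMap R A r) = 0 := by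
    have := Polynomial.scaleRoots_eval₂_eq_zero (algebraMap A L) (s := algebraMap R A s) hpx
    rw [hy, Polynomial.eval₂_at_apply] at this
    exact hLinj (by rw [this, map_zero])
  obtain ⟨z, hz⟩ := hsK.dvd (a := algebraMap R K r)
  have hzint : IsIntegral R z := integral_descent (maximalIdeal R) h1 h2 r s ⟨_, hsM⟩ p hp hpe K z
    hsK hz.symm
  obtain ⟨u, hu'⟩ := hc z hzint
  have hcr : s * u = c * r := hKinj (by rw [map_mul, map_mul, hu', hz]; ring)
  refine ⟨algebraMap R A u + algebraMap R A c * e, hsL.mul_left_cancel ?_⟩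
  have e3 := congrArg (fun w => algebraMap A L (algebraMap R A w)) hcr
  simp only [map_mul] at e3
  rw [map_add, map_mul]
  linear_combination e3 - algebraMap A L (algebraMap R A c) * hy

/-- Let `(R, 𝔪)` be a one-dimensional Noetherian local ring whose `𝔪`-adic completion `R̂` is
reduced.  Then the extension of the conductor of `R` to `R̂` is contained in the conductor of
`R̂`. -/
theorem map_conductor_le_conductor_completion (R : Type u) [CommRing R] [IsNoetherianRing R]
    [IsLocalRing R] (hdim : ringKrullDim R = 1)
    (hred : IsReduced (AdicCompletion (IsLocalRing.maximalIdeal R) R)) :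
    Ideal.map (algebraMap R (AdicCompletion (IsLocalRing.maximalIdeal R) R))
        (conductorIdeal R) ≤
      conductorIdeal (AdicCompletion (IsLocalRing.maximalIdeal R) R) := by
  have hI : (maximalIdeal R).FG := IsNoetherian.noetherian _
  have h1 := comp_h1 (maximalIdeal R) hI
  have h2 := comp_h2 (maximalIdeal R) hI
  have hmax := AdicCompletion.maximalIdeal_eq_map (R := R)
  have hinj : Function.Injective (algebraMap R (AdicCompletion (maximalIdeal R) R)) :=
    AdicCompletion.of_injective (maximalIdeal R) R
  have hcomp : IsAdicComplete (maximalIdeal (AdicCompletion (maximalIdeal R) R))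
    (AdicCompletion (maximalIdeal R) R) := inferInstance
  exact core_conductor hdim h1 h2 hmax hinj hcomp
end

section
/- Let (R, 𝔪) be a one-dimensional Noetherian local ring whose 𝔪-adic completion is reduced, and let 𝒞(R) denote the conductor of R in its integral closure R̄ in Q(R). Then 𝒞(R) equals each of the following ideals of R: (i) the intersection over all i ≥ 1 and all finitely generated torsion-free R-modules M, N of ann_R Ext^i_R(M, N); (ii) the intersection over all i ≥ 2 and all finitely generated torsion-free R-modules M, N of ann_R Ext^i_R(M, N); (iii) the intersection over all i ≥ 1 and all finitely generated torsion-free R-modules M, N of ann_R Tor_i^R(M, N). -/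
open CategoryTheory Opposite

universe u

lemma KA_artin {A : Type*} [CommRing A] [IsDomain A] [IsNoetherianRing A] [Ring.DimensionLEOne A]
    (I : Ideal A) (hI : I ≠ ⊥) : Module.length A (A ⧸ I) ≠ ⊤ := by
  have : Ring.KrullDimLE 0 (A ⧸ I) := by
    refine Ring.KrullDimLE.mk₀ fun P hP => ?_
    have h1 : (P.comap (Ideal.Quotient.mk I)).IsPrime := inferInstance
    have h2 : P.comap (Ideal.Quotient.mk I) ≠ ⊥ := by
      intro h
      apply hI
      rw [eq_bot_iff, ← h]
      intro x hx
      simp [Ideal.mem_comap, Ideal.Quotient.eq_zero_iff_mem.mpr hx]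
    have h3 := h1.isMaximal h2
    have := Ideal.map_eq_top_or_isMaximal_of_surjective (Ideal.Quotient.mk I)
      Ideal.Quotient.mk_surjective h3
    rw [Ideal.map_comap_of_surjective _ Ideal.Quotient.mk_surjective] at this
    rcases this with h | h
    · exact absurd h hP.ne_top
    · exact h
  have h1 : IsArtinianRing (A ⧸ I) := isArtinianRing_iff_krullDimLE_zero.mpr this
  have h2 : IsArtinian A (A ⧸ I) :=
    isArtinian_of_surjective_algebraMap (R := A ⧸ I) Ideal.Quotient.mk_surjective
  exact Module.length_ne_top

lemma KA_length {A : Type*} [CommRing A] [IsDomain A] [IsNoetherianRing A] [Ring.DimensionLEOne A]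
    {M : Type*} [AddCommGroup M] [Module A M] (φ : M →ₗ[A] A) (hφ : Function.Injective φ)
    (a : A) (ha : a ≠ 0) :
    Module.length A (M ⧸ LinearMap.range (LinearMap.lsmul A M a)) ≤
      Module.length A (A ⧸ Ideal.span {a}) := by
  by_cases h0 : LinearMap.range φ = ⊥
  · have : Subsingleton M := by
      refine ⟨fun x y => hφ ?_⟩
      rw [LinearMap.range_eq_bot] at h0
      simp [h0]
    rw [Module.length_eq_zero_iff.mpr inferInstance]
    exact bot_le
  set I : Ideal A := LinearMap.range φ with hI
  set J : Ideal A := Submodule.map (LinearMap.lsmul A A a) I with hJ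
  have hJmem : ∀ x, x ∈ J ↔ ∃ m, a * φ m = x := by
    intro x; simp [hJ, hI]
  have hfin := KA_artin I h0
  have hJI : J ≤ I := by
    intro x hx
    obtain ⟨m, rfl⟩ := (hJmem x).1 hx
    exact I.mul_mem_left _ ⟨m, rfl⟩
  have hJa : J ≤ Ideal.span {a} := by
    intro x hx
    obtain ⟨m, rfl⟩ := (hJmem x).1 hx
    exact Ideal.mul_mem_right _ _ (Ideal.mem_span_singleton_self a)
  have hIJ : I ≤ Submodule.comap (LinearMap.lsmul A A a) J := fun x hx => ⟨x, hx, rfl⟩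
  have hMJ : LinearMap.range (LinearMap.lsmul A M a) ≤ Submodule.comap φ J := by
    rintro _ ⟨m, rfl⟩
    refine (hJmem _).2 ⟨m, by simp⟩
  have e1 := Module.length_eq_add_of_exact (R := A) (Submodule.mapQ I J (LinearMap.lsmul A A a) hIJ)
    (Submodule.factor hJa) ?_ (Submodule.factor_surjective _) ?_
  have e2 := Module.length_eq_add_of_exact (R := A) (Submodule.mapQ _ J φ hMJ)
    (Submodule.factor hJI) ?_ (Submodule.factor_surjective _) ?_
  · rw [e1, add_comm] at e2
    exact ((ENat.add_left_injective_of_ne_top hfin) e2).symm.le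
  · rw [← LinearMap.ker_eq_bot, LinearMap.ker_eq_bot']
    intro x hx
    obtain ⟨m, rfl⟩ := Submodule.Quotient.mk_surjective _ x
    rw [Submodule.mapQ_apply, Submodule.Quotient.mk_eq_zero, hJmem] at hx
    obtain ⟨n, hn⟩ := hx
    rw [Submodule.Quotient.mk_eq_zero]
    exact ⟨n, hφ (by simpa using hn)⟩
  · intro x
    obtain ⟨x, rfl⟩ := Submodule.Quotient.mk_surjective _ x
    rw [← Submodule.mkQ_apply, Submodule.factor_mk]
    constructor
    · intro h
      rw [Submodule.mkQ_apply, Submodule.Quotient.mk_eq_zero] at h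
      obtain ⟨m, rfl⟩ := h
      exact ⟨Submodule.Quotient.mk m, by simp⟩
    · rintro ⟨y, hy⟩
      obtain ⟨m, rfl⟩ := Submodule.Quotient.mk_surjective _ y
      rw [Submodule.mapQ_apply, Submodule.mkQ_apply, Submodule.Quotient.eq] at hy
      rw [Submodule.mkQ_apply, Submodule.Quotient.mk_eq_zero]
      have h1 : φ m ∈ I := ⟨m, rfl⟩
      have := I.sub_mem h1 (hJI hy)
      simpa using this
  · rw [← LinearMap.ker_eq_bot, LinearMap.ker_eq_bot']
    intro x hx
    obtain ⟨m, rfl⟩ := Submodule.Quotient.mk_surjective _ x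
    rw [Submodule.mapQ_apply, Submodule.Quotient.mk_eq_zero, hJmem] at hx
    obtain ⟨n, hn⟩ := hx
    rw [Submodule.Quotient.mk_eq_zero]
    exact ⟨n, mul_left_cancel₀ ha (by simpa using hn)⟩
  · intro x
    obtain ⟨x, rfl⟩ := Submodule.Quotient.mk_surjective _ x
    rw [← Submodule.mkQ_apply, Submodule.factor_mk]
    constructor
    · intro h
      rw [Submodule.mkQ_apply, Submodule.Quotient.mk_eq_zero, Ideal.mem_span_singleton'] at h
      obtain ⟨m, rfl⟩ := h
      refine ⟨Submodule.Quotient.mk m, ?_⟩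
      rw [Submodule.mapQ_apply, LinearMap.lsmul_apply, smul_eq_mul, mul_comm]
      rfl
    · rintro ⟨y, hy⟩
      obtain ⟨m, rfl⟩ := Submodule.Quotient.mk_surjective _ y
      rw [Submodule.mapQ_apply, Submodule.mkQ_apply, Submodule.Quotient.eq] at hy
      rw [Submodule.mkQ_apply, Submodule.Quotient.mk_eq_zero]
      have h1 : a * m ∈ Ideal.span {a} := Ideal.mul_mem_right _ _ (Ideal.mem_span_singleton_self a)
      have := Submodule.sub_mem _ h1 (hJa hy)
      simpa using this

lemma fg_of_length_bound {A X : Type*} [CommRing A] [AddCommGroup X] [Module A X] (l : ℕ∞)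
    (hl : l ≠ ⊤) (h : ∀ F : Submodule A X, F.FG → Module.length A F ≤ l) : Module.Finite A X := by
  classical
  obtain ⟨n, rfl⟩ := ENat.ne_top_iff_exists.mp hl
  -- pick F with maximal length
  have key : ∃ F : Submodule A X, F.FG ∧ ∀ G : Submodule A X, G.FG →
      Module.length A G ≤ Module.length A F := by
    by_contra hcon
    push Not at hcon
    have : ∀ k : ℕ, ∃ F : Submodule A X, F.FG ∧ (k : ℕ∞) ≤ Module.length A F := by
      intro k
      induction k with
      | zero => exact ⟨⊥, Submodule.fg_bot, by simp⟩
      | succ k ih =>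
        obtain ⟨F, hF, hk⟩ := ih
        obtain ⟨G, hG, hlt⟩ := hcon F hF
        refine ⟨G, hG, ?_⟩
        push_cast
        exact Order.add_one_le_of_lt (lt_of_le_of_lt hk hlt)
    obtain ⟨F, hF, hk⟩ := this (n + 1)
    have := hk.trans (h F hF)
    norm_cast at this
    omega
  obtain ⟨F, hF, hmax⟩ := key
  refine ⟨?_⟩
  convert hF
  symm
  rw [eq_top_iff]
  intro x _
  by_contra hx
  set G := F ⊔ Submodule.span A {x} with hG
  have hGfg : G.FG := hF.sup (Submodule.fg_span_singleton x)
  have hfl : IsFiniteLength A G := Module.length_ne_top_iff.mp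
    (ne_top_of_le_ne_top hl (h G hGfg))
  obtain ⟨h1, h2⟩ := isFiniteLength_iff_isNoetherian_isArtinian.mp hfl
  have hlt := Submodule.length_lt (R := A) (M := G) (N := F.comap G.subtype) (by
    intro htop
    have : (⟨x, le_sup_right (a := F) (Submodule.mem_span_singleton_self x)⟩ : G) ∈
      F.comap G.subtype := by rw [htop]; trivial
    exact hx this)
  have e := (Submodule.comapSubtypeEquivOfLe (le_sup_left : F ≤ G)).length_eq
  rw [e] at hlt
  exact absurd (hmax G hGfg) (not_le.mpr hlt)

lemma KA_quot {A K : Type*} [CommRing A] [IsDomain A] [IsNoetherianRing A] [Ring.DimensionLEOne A]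
    [Field K] [Algebra A K] [IsFractionRing A K] (B : Subalgebra A K) (a : A) (ha : a ≠ 0) :
    Module.Finite A (B ⧸ LinearMap.range (LinearMap.lsmul A B a)) := by
  classical
  refine fg_of_length_bound (Module.length A (A ⧸ Ideal.span {a}))
    (KA_artin _ (by simpa using ha)) ?_
  intro F hF
  obtain ⟨s, rfl⟩ := hF
  -- lift
  obtain ⟨t, ht⟩ : ∃ t : Finset B, t.image (Submodule.mkQ
      (LinearMap.range (LinearMap.lsmul A B a))) = s := by
    have := Finset.subset_set_image_iff (s := (Set.univ : Set B)) (t := s) (f := Submodule.mkQ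
      (LinearMap.range (LinearMap.lsmul A B a)))
    obtain ⟨t, _, h⟩ := this.1 (by
      intro x _; simpa using Submodule.mkQ_surjective _ x)
    exact ⟨t, h⟩
  set M : Submodule A B := Submodule.span A t with hM
  obtain ⟨d, hd⟩ := IsLocalization.exist_integer_multiples_of_finset (nonZeroDivisors A)
    (t.image (fun b : B => (b : K)))
  have hd' : ∀ m : M, ((d : A) • ((m : B) : K)) ∈ LinearMap.range (Algebra.linearMap A K) := by
    rintro ⟨m, hm⟩
    induction hm using Submodule.span_induction with
    | mem x hx =>
      obtain ⟨y, hy⟩ := hd x (Finset.mem_image_of_mem _ hx)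
      exact ⟨y, by simpa using hy⟩
    | zero => simp
    | add x y hx hy h1 h2 =>
      simpa [smul_add] using Submodule.add_mem _ h1 h2
    | smul c x hx h1 =>
      have := Submodule.smul_mem _ c h1
      rw [smul_comm] at this
      simpa using this
  let ψ : M →ₗ[A] K := (LinearMap.lsmul A K (d : A)) ∘ₗ B.val.toLinearMap ∘ₗ M.subtype
  have hψ : Function.Injective ψ := by
    intro x y hxy
    have hd0 : (d : A) ≠ 0 := nonZeroDivisors.coe_ne_zero d
    have : (d : A) • ((x : B) : K) = (d : A) • ((y : B) : K) := hxy
    rw [Algebra.smul_def, Algebra.smul_def] at this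
    have h2 := mul_left_cancel₀ (by simp) this
    exact Subtype.ext (Subtype.ext h2)
  let ι := LinearEquiv.ofInjective (Algebra.linearMap A K) (IsFractionRing.injective A K)
  let φ : M →ₗ[A] A := ι.symm.toLinearMap ∘ₗ ψ.codRestrict _ hd'
  have hφ : Function.Injective φ := by
    apply ι.symm.injective.comp
    intro x y hxy
    exact hψ (congrArg Subtype.val hxy)
  refine le_trans ?_ (KA_length φ hφ a ha)
  -- surjection
  have hspan : Submodule.span A (s : Set _) = M.map (Submodule.mkQ
      (LinearMap.range (LinearMap.lsmul A B a))) := by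
    rw [hM, Submodule.map_span, ← ht, Finset.coe_image]
  rw [hspan]
  let g : M →ₗ[A] (M.map (Submodule.mkQ (LinearMap.range (LinearMap.lsmul A B a)))) :=
    (Submodule.mkQ (LinearMap.range (LinearMap.lsmul A B a))).submoduleMap M
  have hg : Function.Surjective g := LinearMap.submoduleMap_surjective _ _
  refine Module.length_le_of_surjective (Submodule.liftQ _ g ?_) ?_
  · rintro _ ⟨m, rfl⟩
    rw [LinearMap.mem_ker]
    apply Subtype.ext
    change Submodule.mkQ _ ((a • m : M) : B) = 0
    rw [Submodule.mkQ_apply, Submodule.Quotient.mk_eq_zero]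
    exact ⟨m, by simp⟩
  · intro y
    obtain ⟨m, rfl⟩ := hg y
    exact ⟨Submodule.Quotient.mk m, rfl⟩

theorem KA_noeth {A K : Type*} [CommRing A] [IsDomain A] [IsNoetherianRing A]
    [Ring.DimensionLEOne A]
    [Field K] [Algebra A K] [IsFractionRing A K] (B : Subalgebra A K) : IsNoetherianRing B := by
  rw [isNoetherianRing_iff_ideal_fg]
  intro J
  by_cases hJ : J = ⊥
  · subst hJ; exact Submodule.fg_bot
  obtain ⟨x, hxJ, hx0⟩ := Submodule.exists_mem_ne_zero_of_ne_bot hJ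
  obtain ⟨n, d, hd, hnd⟩ := IsFractionRing.div_surjective (A := A) (x : K)
  have hd0 : algebraMap A K d ≠ 0 := by
    simpa using nonZeroDivisors.ne_zero hd
  have hn : algebraMap A B n = algebraMap A B d * x := by
    apply Subtype.ext
    change algebraMap A K n = algebraMap A K d * x
    rw [← hnd]; field_simp
  have hn0 : n ≠ 0 := by
    rintro rfl
    apply hx0
    apply Subtype.ext
    change (x : K) = 0
    rw [← hnd]; simp
  have hnJ : algebraMap A B n ∈ J := hn ▸ J.mul_mem_left _ hxJ
  have hfin := KA_quot B n hn0
  have hnoe : IsNoetherian A (B ⧸ Ideal.span {algebraMap A B n}) := by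
    refine isNoetherian_of_surjective (M := B ⧸ LinearMap.range (LinearMap.lsmul A B n))
      (Submodule.liftQ _ ((Submodule.mkQ (Ideal.span {algebraMap A B n})).restrictScalars A) ?_) ?_
    · rintro _ ⟨m, rfl⟩
      have h1 : n • m ∈ Ideal.span {algebraMap A B n} := by
        rw [Algebra.smul_def]
        exact Ideal.mul_mem_right _ _ (Ideal.mem_span_singleton_self _)
      rw [LinearMap.mem_ker, LinearMap.lsmul_apply, LinearMap.restrictScalars_apply,
        Submodule.mkQ_apply]
      exact (Submodule.Quotient.mk_eq_zero _).2 h1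
    · rw [LinearMap.range_eq_top]
      intro y
      obtain ⟨m, rfl⟩ := Submodule.Quotient.mk_surjective _ y
      exact ⟨Submodule.Quotient.mk m, rfl⟩
  have hnoeB : IsNoetherian B (B ⧸ Ideal.span {algebraMap A B n}) := isNoetherian_of_tower A hnoe
  refine Submodule.fg_of_fg_map_of_fg_inf_ker (Submodule.mkQ (Ideal.span {algebraMap A B n}))
    (IsNoetherian.noetherian _) ?_
  rw [Submodule.ker_mkQ, inf_eq_right.mpr]
  · exact ⟨{algebraMap A B n}, by simp⟩
  · rw [Ideal.span_le]; simpa using hnJ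
lemma Q_artin (R : Type*) [CommRing R] [IsNoetherianRing R] [IsReduced R] :
    IsArtinianRing (Localization (nonZeroDivisors R)) := by
  have hN : IsNoetherianRing (Localization (nonZeroDivisors R)) :=
    IsLocalization.isNoetherianRing (nonZeroDivisors R) _ inferInstance
  rw [isArtinianRing_iff_krullDimLE_zero]
  have key : ∀ P : Ideal (Localization (nonZeroDivisors R)), P.IsPrime →
      P.comap (algebraMap R _) ∈ minimalPrimes R := by
    intro P hP
    have hp : (P.comap (algebraMap R _)).IsPrime := inferInstance
    have hdis := ((IsLocalization.isPrime_iff_isPrime_disjoint (nonZeroDivisors R) _ P).1 hP).2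
    have hsub : ((P.comap (algebraMap R _) : Ideal R) : Set R) ⊆
        ⋃ q ∈ (minimalPrimes.finite_of_isNoetherianRing R).toFinset, (q : Set R) := by
      intro x hx
      have hx' : x ∉ nonZeroDivisors R := fun h => Set.disjoint_left.mp hdis h hx
      have := Ideal.iUnion_minimalPrimes (I := (⊥ : Ideal R))
      have hrad : (⊥ : Ideal R).radical = ⊥ := by
        exact nilradical_eq_zero R
      rw [hrad] at this
      have hx2 : x ∈ ⋃ p ∈ (⊥ : Ideal R).minimalPrimes, (p : Set R) := by
        rw [this]
        rw [mem_nonZeroDivisors_iff_right] at hx'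
        push Not at hx'
        obtain ⟨y, h1, h2⟩ := hx'
        exact ⟨y, by simpa using h2, by simpa [mul_comm] using h1⟩
      simpa using! hx2
    obtain ⟨q, hq, hle⟩ := (Ideal.subset_union_prime ⊥ ⊥ (by
      intro q hq _ _
      simp only [Set.Finite.mem_toFinset] at hq
      exact hq.1.1)).1 hsub
    simp only [Set.Finite.mem_toFinset] at hq
    have := hq.2 ⟨hp, bot_le⟩ hle
    rwa [le_antisymm hle this]
  refine Ring.KrullDimLE.mk₀ fun P hP => ?_
  obtain ⟨M, hM, hPM⟩ := P.exists_le_maximal hP.ne_top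
  have h1 := key M hM.isPrime
  have h2 : (P.comap (algebraMap R _)).IsPrime := inferInstance
  have h3 : P.comap (algebraMap R _) = M.comap (algebraMap R _) :=
    le_antisymm (Ideal.comap_mono hPM) (h1.2 ⟨h2, bot_le⟩ (Ideal.comap_mono hPM))
  have h4 : P = M := by
    rw [← IsLocalization.map_under (nonZeroDivisors R) _ P,
      ← IsLocalization.map_under (nonZeroDivisors R) _ M]
    exact congrArg (Ideal.map _) h3
  exact h4 ▸ hM

lemma dedekind_comp {R K : Type*} [CommRing R] [IsNoetherianRing R] [Ring.KrullDimLE 1 R] [Field K]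
    [Algebra R K] (hK : ∀ x : K, ∃ a b : R, algebraMap R K b ≠ 0 ∧ algebraMap R K b * x =
      algebraMap R K a) : IsDedekindDomain (integralClosure R K) := by
  let A : Subring K := (algebraMap R K).range
  have hsurj : Function.Surjective (algebraMap R K).rangeRestrict :=
    (algebraMap R K).rangeRestrict_surjective
  have hA : IsNoetherianRing A := isNoetherianRing_of_surjective R A _ hsurj
  have hA1 : Ring.KrullDimLE 1 A := by
    rw [Ring.krullDimLE_iff]
    exact (ringKrullDim_le_of_surjective _ hsurj).trans (Ring.krullDimLE_iff.1 inferInstance)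
  have hA2 : Ring.DimensionLEOne A :=
    ⟨fun {p} h1 h2 => Ring.krullDimLE_one_iff_of_isPrime_bot.1 hA1 p h1 h2⟩
  have hF : IsFractionRing A K := by
    refine IsFractionRing.of_field A K fun z => ?_
    obtain ⟨a, b, hb, h⟩ := hK z
    refine ⟨⟨algebraMap R K a, a, rfl⟩, ⟨algebraMap R K b, b, rfl⟩, ?_⟩
    change z = algebraMap R K a / algebraMap R K b
    rw [← h]; field_simp
  have hint : ∀ x : K, IsIntegral R x ↔ IsIntegral A x := by
    intro x
    constructor
    · intro h
      obtain ⟨p, hp, h0⟩ := h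
      refine ⟨p.map (algebraMap R K).rangeRestrict, hp.map _, ?_⟩
      rw [Polynomial.eval₂_map]
      exact h0
    · intro h
      obtain ⟨p, hp, h0⟩ := h
      obtain ⟨q, hq, _, hq'⟩ := Polynomial.lifts_and_natDegree_eq_and_monic
        (f := (algebraMap R K).rangeRestrict)
        ((Polynomial.mem_lifts _).2 (Polynomial.map_surjective _ hsurj p)) hp
      refine ⟨q, hq', ?_⟩
      rw [← hq, Polynomial.eval₂_map] at h0
      exact h0
  let e : integralClosure R K ≃+* integralClosure A K :=
    { toFun := fun x => ⟨x.1, (hint _).1 x.2⟩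
      invFun := fun x => ⟨x.1, (hint _).2 x.2⟩
      left_inv := fun x => rfl
      right_inv := fun x => rfl
      map_mul' := fun x y => rfl
      map_add' := fun x y => rfl }
  have h1 : IsNoetherianRing (integralClosure A K) := KA_noeth _
  have h2 : Ring.DimensionLEOne (integralClosure A K) := inferInstance
  have h3 : IsIntegrallyClosed (integralClosure A K) :=
    integralClosure.isIntegrallyClosedOfFiniteExtension K
  have g1 : IsNoetherianRing (integralClosure R K) := isNoetherianRing_of_ringEquiv _ e.symm
  have g2 : Ring.DimensionLEOne (integralClosure R K) := Ring.DimensionLEOne.of_ringEquiv e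
  have g3 : IsIntegrallyClosed (integralClosure R K) := IsIntegrallyClosed.of_equiv e.symm
  exact { }

lemma split_comp {D K V : Type*} [CommRing D] [IsDedekindDomain D] [Field K] [Algebra D K]
    [FaithfulSMul D K]
    [AddCommGroup V] [Module D V] [Module K V] [IsScalarTower D K V] {n : ℕ} (m : Fin n → V) :
    ∃ s : Submodule.span D (Set.range m) →ₗ[D] (Fin n → D), ∀ x, ∑ j, s x j • m j = (x : V) := by
  have htf : Module.IsTorsionFree D V := Module.IsTorsionFree.trans_faithfulSMul D K V
  have hfin : Module.Finite D (Submodule.span D (Set.range m)) :=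
    Module.Finite.span_of_finite D (Set.finite_range m)
  have hfp : Module.FinitePresentation D (Submodule.span D (Set.range m)) :=
    Module.finitePresentation_of_finite D _
  have hproj : Module.Projective D (Submodule.span D (Set.range m)) :=
    Module.Flat.projective_of_finitePresentation
  let p : (Fin n → D) →ₗ[D] Submodule.span D (Set.range m) :=
    (Fintype.linearCombination D m).codRestrict _ (fun x => by
      rw [← Fintype.range_linearCombination]; exact ⟨x, rfl⟩)
  have hp : Function.Surjective p := by
    rintro ⟨x, hx⟩
    have hx' := hx
    rw [← Fintype.range_linearCombination] at hx'
    obtain ⟨y, rfl⟩ := hx'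
    exact ⟨y, rfl⟩
  obtain ⟨s, hs⟩ := Module.projective_lifting_property p LinearMap.id hp
  refine ⟨s, fun x => ?_⟩
  have := congrArg Subtype.val (LinearMap.congr_fun hs x)
  simpa [p, Fintype.linearCombination_apply] using this


lemma mem_conductorIdeal_iff {S : Type u} [CommRing S] (c : S) : c ∈ conductorIdeal S ↔
    ∀ y : Localization (nonZeroDivisors S), IsIntegral S y →
      ∃ r : S, algebraMap S _ r = algebraMap S _ c * y := by
  rw [conductorIdeal, Submodule.mem_comap, Submodule.mem_div_iff_forall_mul_mem]
  simp only [Submodule.mem_one]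
  rfl

lemma core_split_aux (R : Type u) [CommRing R] [IsNoetherianRing R] [Ring.KrullDimLE 1 R]
    {ι : Type*} [Fintype ι] [DecidableEq ι] (K : ι → Type u) [∀ i, Field (K i)]
    [∀ i, Algebra R (K i)]
    (e : Localization (nonZeroDivisors R) ≃ₐ[R] (∀ i, K i))
    (c : R) (hc : c ∈ conductorIdeal R) (M : Type u) [AddCommGroup M] [Module R M]
    [Module.Finite R M] (hM : Submodule.torsion R M = ⊥) :
    ∃ (n : ℕ) (s : M →ₗ[R] (Fin n → R)) (p : (Fin n → R) →ₗ[R] M), ∀ x, p (s x) = c • x := by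
  classical
  let Q := Localization (nonZeroDivisors R)
  rw [mem_conductorIdeal_iff] at hc
  -- each K i consists of fractions
  have hK : ∀ i, ∀ x : K i, ∃ a b : R, algebraMap R (K i) b ≠ 0 ∧
      algebraMap R (K i) b * x = algebraMap R (K i) a := by
    intro i x
    obtain ⟨⟨a, b⟩, hab⟩ := IsLocalization.surj (nonZeroDivisors R) (e.symm (Pi.single i x))
    have hu : IsUnit (algebraMap R (K i) b) := by
      have h1 := IsLocalization.map_units Q b
      have h2 := (h1.map e).map (Pi.evalRingHom K i)
      simpa using h2
    refine ⟨a, b, hu.ne_zero, ?_⟩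
    have := congrFun (congrArg e hab) i
    simp only [map_mul, AlgEquiv.apply_symm_apply, AlgEquiv.commutes] at this
    simpa [mul_comm] using this
  have hD : ∀ i, IsDedekindDomain (integralClosure R (K i)) := fun i => dedekind_comp (hK i)
  -- generators
  obtain ⟨n, m, hm⟩ := Module.Finite.exists_fin (R := R) (M := M)
  let f : ∀ i, M →ₗ[R] TensorProduct R (K i) M := fun i => TensorProduct.mk R (K i) M 1
  have hfinj : ∀ x : M, (∀ i, f i x = 0) → x = 0 := by
    intro x hx
    have h1 : (1 : Q) ⊗ₜ[R] x = 0 := by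
      have hid : (1 : Q) = ∑ i, e.symm (Pi.single i (1 : K i)) := by
        rw [← map_sum, Finset.univ_sum_single]
        exact (map_one e.symm).symm
      rw [hid, TensorProduct.sum_tmul]
      refine Finset.sum_eq_zero fun i _ => ?_
      have := congrArg (LinearMap.rTensor M (e.symm.toLinearMap ∘ₗ LinearMap.single R K i)) (hx i)
      simpa [f] using this
    have h2 := (IsLocalizedModule.eq_zero_iff (nonZeroDivisors R) (TensorProduct.mk R Q M 1)
      (m := x)).1 h1
    obtain ⟨b, hb⟩ := h2
    have : x ∈ Submodule.torsion R M := ⟨b, hb⟩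
    rw [hM] at this
    exact this
  choose s hs using fun i => split_comp (D := integralClosure R (K i)) (K := K i)
    (V := TensorProduct R (K i) M) (fun j => f i (m j))
  have hmem : ∀ i x, f i x ∈ Submodule.span (integralClosure R (K i))
      (Set.range (fun j => f i (m j))) := by
    intro i x
    have hx : x ∈ Submodule.span R (Set.range m) := hm ▸ trivial
    have h1 : f i x ∈ (Submodule.span R (Set.range m)).map (f i) := ⟨x, hx, rfl⟩
    rw [Submodule.map_span, ← Set.range_comp] at h1
    exact Submodule.span_le_restrictScalars R _ _ h1
  let g : ∀ i, M →ₗ[R] (Fin n → integralClosure R (K i)) := fun i =>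
    (s i).restrictScalars R ∘ₗ (LinearMap.codRestrict
      ((Submodule.span (integralClosure R (K i)) (Set.range (fun j => f i (m j)))).restrictScalars R)
      (f i) (hmem i))
  have hg : ∀ i x, ∑ j, ((g i x j : integralClosure R (K i)) : K i) • f i (m j) = f i x := by
    intro i x
    exact hs i ⟨f i x, hmem i x⟩
  let T : Fin n → M →ₗ[R] Q := fun j => e.symm.toLinearMap ∘ₗ
    LinearMap.pi (fun i => (integralClosure R (K i)).val.toLinearMap ∘ₗ LinearMap.proj j ∘ₗ g i)
  have hTi : ∀ j x, e (T j x) = fun i => (g i x j : K i) := by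
    intro j x
    simp only [T, LinearMap.comp_apply, AlgEquiv.toLinearMap_apply, AlgEquiv.apply_symm_apply]
    rfl
  have hTint : ∀ j x, IsIntegral R (T j x) := by
    intro j x
    rw [← isIntegral_algEquiv e, hTi]
    choose p hp hp0 using fun i => (g i x j).2
    refine ⟨∏ i, p i, Polynomial.monic_prod_of_monic _ _ (fun i _ => hp i), ?_⟩
    rw [← Polynomial.aeval_def]
    funext i
    have h1 := Polynomial.aeval_algHom_apply (Pi.evalAlgHom R K i)
      (fun i => ((g i x j : integralClosure R (K i)) : K i)) (∏ i, p i)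
    have h2 : Polynomial.aeval ((g i x j : integralClosure R (K i)) : K i) (∏ i, p i) = 0 := by
      rw [map_prod]
      refine Finset.prod_eq_zero (Finset.mem_univ i) ?_
      rw [Polynomial.aeval_def]
      exact hp0 i
    exact h1.symm.trans h2
  have hr : ∀ j x, c • T j x ∈ LinearMap.range (Algebra.linearMap R Q) := by
    intro j x
    obtain ⟨r, hr⟩ := hc _ (hTint j x)
    exact ⟨r, by rw [Algebra.smul_def]; exact hr⟩
  let ιe := LinearEquiv.ofInjective (Algebra.linearMap R Q) (IsFractionRing.injective R Q)
  let S : Fin n → M →ₗ[R] R := fun j => ιe.symm.toLinearMap ∘ₗ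
    LinearMap.codRestrict _ (c • T j) (hr j)
  have hS : ∀ j x, algebraMap R Q (S j x) = c • T j x := by
    intro j x
    have : ιe (S j x) = LinearMap.codRestrict _ (c • T j) (hr j) x := by
      simp [S]
    exact congrArg Subtype.val this
  refine ⟨n, LinearMap.pi S, Fintype.linearCombination R m, fun x => ?_⟩
  rw [← sub_eq_zero]
  refine hfinj _ fun i => ?_
  rw [map_sub, sub_eq_zero, map_smul, ← hg i x, Fintype.linearCombination_apply, map_sum,
    Finset.smul_sum]
  refine Finset.sum_congr rfl fun j _ => ?_
  have h1 := congrFun (congrArg e (hS j x)) i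
  rw [AlgEquiv.commutes, map_smul, hTi] at h1
  rw [map_smul, LinearMap.pi_apply, ← smul_assoc, ← algebraMap_smul (K i) (S j x)]
  congr 1

theorem core_split (R : Type u) [CommRing R] [IsNoetherianRing R] [IsReduced R]
    [Ring.KrullDimLE 1 R] (c : R) (hc : c ∈ conductorIdeal R) (M : Type u) [AddCommGroup M]
    [Module R M] [Module.Finite R M] (hM : Submodule.torsion R M = ⊥) :
    ∃ (n : ℕ) (s : M →ₗ[R] (Fin n → R)) (p : (Fin n → R) →ₗ[R] M), ∀ x, p (s x) = c • x := by
  classical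
  have := Q_artin R
  have : IsReduced (Localization (nonZeroDivisors R)) := inferInstance
  have : Fintype (MaximalSpectrum (Localization (nonZeroDivisors R))) := Fintype.ofFinite _
  let : ∀ i : MaximalSpectrum (Localization (nonZeroDivisors R)),
    Field (Localization (nonZeroDivisors R) ⧸ i.asIdeal) := fun i => Ideal.Quotient.field _
  exact core_split_aux R (fun i : MaximalSpectrum (Localization (nonZeroDivisors R)) =>
      Localization (nonZeroDivisors R) ⧸ i.asIdeal)
    ((IsArtinianRing.equivPi (Localization (nonZeroDivisors R))).restrictScalars R) c hc M hM


lemma ann_iso {R : Type*} [CommRing R] {X Y : ModuleCat R} (e : X ≅ Y) :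
    Module.annihilator R X = Module.annihilator R Y :=
  e.toLinearEquiv.annihilator_eq

lemma mem_ann_homology {R : Type*} [CommRing R] (S : ShortComplex (ModuleCat R)) (r : R) :
    r ∈ Module.annihilator R S.homology ↔
      ∀ x : S.X₂, S.g.hom x = 0 → ∃ y : S.X₁, S.f.hom y = r • x := by
  rw [ann_iso S.moduleCatHomologyIso, Module.mem_annihilator]
  constructor
  · intro h x hx
    have h1 := h (Submodule.Quotient.mk (⟨x, hx⟩ : LinearMap.ker S.g.hom))
    have h2 : Submodule.Quotient.mk (p := LinearMap.range S.moduleCatToCycles)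
      (r • (⟨x, hx⟩ : LinearMap.ker S.g.hom)) = 0 := h1
    rw [Submodule.Quotient.mk_eq_zero] at h2
    obtain ⟨y, hy⟩ := h2
    exact ⟨y, congrArg Subtype.val hy⟩
  · intro h z
    obtain ⟨⟨x, hx⟩, rfl⟩ := Submodule.Quotient.mk_surjective
      (LinearMap.range S.moduleCatToCycles) z
    obtain ⟨y, hy⟩ := h x hx
    have h2 : Submodule.Quotient.mk (p := LinearMap.range S.moduleCatToCycles)
      (r • (⟨x, hx⟩ : LinearMap.ker S.g.hom)) = 0 := by
      rw [Submodule.Quotient.mk_eq_zero]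
      exact ⟨y, Subtype.ext hy⟩
    exact h2

lemma mem_ann_ext {R : Type u} [CommRing R] {M : ModuleCat.{u} R} (P : ProjectiveResolution M)
    (N : ModuleCat.{u} R) (n : ℕ) (r : R) :
    r ∈ Module.annihilator R (((Ext R (ModuleCat.{u} R) (n + 1)).obj (op M)).obj N) ↔
    ∀ f : P.complex.X (n + 1) →ₗ[R] N, f ∘ₗ (P.complex.d (n + 2) (n + 1)).hom = 0 →
      ∃ h : P.complex.X n →ₗ[R] N, h ∘ₗ (P.complex.d (n + 1) n).hom = r • f := by
  rw [ann_iso (P.isoExt (n + 1) N),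
    ann_iso (HomologicalComplex.homologyIsoSc' _ n (n + 1) (n + 2) (by simp) (by simp)),
    mem_ann_homology]
  constructor
  · intro h f hf
    obtain ⟨y, hy⟩ := h (ModuleCat.ofHom f) (ModuleCat.hom_ext hf)
    refine ⟨y.hom, congrArg ModuleCat.Hom.hom hy⟩
  · intro h f hf
    obtain ⟨y, hy⟩ := h f.hom (congrArg ModuleCat.Hom.hom hf)
    refine ⟨ModuleCat.ofHom y, ModuleCat.hom_ext hy⟩

lemma mem_ann_tor {R : Type u} [CommRing R] (A : ModuleCat.{u} R) {B : ModuleCat.{u} R}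
    (P : ProjectiveResolution B) (n : ℕ) (r : R) :
    r ∈ Module.annihilator R (((Tor (ModuleCat.{u} R) (n + 1)).obj A).obj B) ↔
    ∀ z : TensorProduct R A (P.complex.X (n + 1)),
      LinearMap.lTensor A (P.complex.d (n + 1) n).hom z = 0 →
      ∃ w : TensorProduct R A (P.complex.X (n + 2)),
        LinearMap.lTensor A (P.complex.d (n + 2) (n + 1)).hom w = r • z := by
  have e1 := P.isoLeftDerivedObj ((MonoidalCategory.tensoringLeft (ModuleCat.{u} R)).obj A) (n + 1)
  have h1 := ann_iso e1
  change r ∈ Module.annihilator R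
    ((((MonoidalCategory.tensoringLeft (ModuleCat.{u} R)).obj A).leftDerived (n + 1)).obj B) ↔ _
  rw [h1, HomologicalComplex.homologyFunctor_obj,
    ann_iso (HomologicalComplex.homologyIsoSc' _ (n + 2) (n + 1) n (by simp) (by simp)),
    mem_ann_homology]
  rfl


lemma lift_exact {R P X Y Z : Type*} [CommRing R] [AddCommGroup P] [AddCommGroup X]
    [AddCommGroup Y] [AddCommGroup Z] [Module R P] [Module R X] [Module R Y] [Module R Z]
    [Module.Projective R P] (f : X →ₗ[R] Y) (f' : Y →ₗ[R] Z)
    (hex : ∀ y, f' y = 0 → ∃ x, f x = y) (g : P →ₗ[R] Y) (hg : ∀ p, f' (g p) = 0) :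
    ∃ h : P →ₗ[R] X, ∀ p, f (h p) = g p := by
  obtain ⟨h, hh⟩ := Module.projective_lifting_property f.rangeRestrict
    (g.codRestrict (LinearMap.range f) (fun p => hex _ (hg p))) f.surjective_rangeRestrict
  exact ⟨h, fun p => congrArg Subtype.val (LinearMap.congr_fun hh p)⟩

lemma lift_surj {R P X Y : Type*} [CommRing R] [AddCommGroup P] [AddCommGroup X]
    [AddCommGroup Y] [Module R P] [Module R X] [Module R Y]
    [Module.Projective R P] (f : X →ₗ[R] Y) (hf : Function.Surjective f) (g : P →ₗ[R] Y) :
    ∃ h : P →ₗ[R] X, ∀ p, f (h p) = g p := by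
  obtain ⟨h, hh⟩ := Module.projective_lifting_property f g hf
  exact ⟨h, fun p => LinearMap.congr_fun hh p⟩

lemma res_proj {R : Type u} [CommRing R] {M : ModuleCat.{u} R} (P : ProjectiveResolution M)
    (n : ℕ) : Module.Projective R (P.complex.X n) :=
  (IsProjective.iff_projective (R := R) (P.complex.X n)).2 (P.projective n)

lemma res_dd {R : Type u} [CommRing R] {M : ModuleCat.{u} R} (P : ProjectiveResolution M)
    (n : ℕ) (x : P.complex.X (n + 2)) :
    (P.complex.d (n + 1) n).hom ((P.complex.d (n + 2) (n + 1)).hom x) = 0 := by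
  have := congrArg ModuleCat.Hom.hom (P.complex.d_comp_d (n + 2) (n + 1) n)
  exact LinearMap.congr_fun this x

lemma res_exact_s15 {R : Type u} [CommRing R] {M : ModuleCat.{u} R} (P : ProjectiveResolution M)
    (n : ℕ) (x : P.complex.X (n + 1)) (hx : (P.complex.d (n + 1) n).hom x = 0) :
    ∃ y, (P.complex.d (n + 2) (n + 1)).hom y = x := by
  have := P.exact_succ n
  rw [ShortComplex.moduleCat_exact_iff] at this
  exact this x hx

lemma res_zero {R : Type u} [CommRing R] {M : ModuleCat.{u} R} (P : ProjectiveResolution M) :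
    ∃ ε : P.complex.X 0 →ₗ[R] M, Function.Surjective ε ∧
      (∀ x, ε x = 0 → ∃ y, (P.complex.d 1 0).hom y = x) ∧
      ∀ y, ε ((P.complex.d 1 0).hom y) = 0 := by
  refine ⟨(P.π.f 0).hom, ?_, ?_, ?_⟩
  · exact (ModuleCat.epi_iff_surjective (P.π.f 0)).1 inferInstance
  · intro x hx
    have h : (ShortComplex.mk _ _ P.complex_d_comp_π_f_zero).Exact :=
      ShortComplex.exact_of_g_is_cokernel _ P.isColimitCokernelCofork
    rw [ShortComplex.moduleCat_exact_iff] at h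
    exact h x hx
  · intro y
    have := congrArg ModuleCat.Hom.hom P.complex_d_comp_π_f_zero
    exact LinearMap.congr_fun this y

lemma homotopy_exists {R : Type u} [CommRing R] {M : ModuleCat.{u} R} (P : ProjectiveResolution M)
    (r : R) (k : ℕ) (s : M →ₗ[R] (Fin k → R)) (p : (Fin k → R) →ₗ[R] M)
    (hsp : ∀ x, p (s x) = r • x) (n : ℕ) :
    ∃ (h : P.complex.X n →ₗ[R] P.complex.X (n + 1))
      (h' : P.complex.X (n + 1) →ₗ[R] P.complex.X (n + 2)),
      ∀ x, (P.complex.d (n + 2) (n + 1)).hom (h' x) =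
        r • x - h ((P.complex.d (n + 1) n).hom x) := by
  have hP := res_proj P
  have step : ∀ (n : ℕ) (h : P.complex.X n →ₗ[R] P.complex.X (n + 1)),
      (∀ x, (P.complex.d (n + 1) n).hom (r • x - h ((P.complex.d (n + 1) n).hom x)) = 0) →
      ∃ h' : P.complex.X (n + 1) →ₗ[R] P.complex.X (n + 2),
      ∀ x, (P.complex.d (n + 2) (n + 1)).hom (h' x) =
        r • x - h ((P.complex.d (n + 1) n).hom x) := by
    intro n h hh
    exact lift_exact _ _ (res_exact_s15 P n)
      (r • LinearMap.id - h ∘ₗ (P.complex.d (n + 1) n).hom) hh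
  have claim : ∀ n, ∃ (h : P.complex.X n →ₗ[R] P.complex.X (n + 1)),
      ∀ x, (P.complex.d (n + 1) n).hom (r • x - h ((P.complex.d (n + 1) n).hom x)) = 0 := by
    intro n
    induction n with
    | zero =>
      obtain ⟨ε, hε, hex, hεd⟩ := res_zero P
      obtain ⟨pt, hpt⟩ := lift_surj ε hε p
      obtain ⟨h, hh⟩ := lift_exact _ _ hex (r • LinearMap.id - pt ∘ₗ s ∘ₗ ε) (by
        intro x
        simp [hpt, hsp])
      refine ⟨h, fun x => ?_⟩
      rw [map_sub, hh]
      simp [hεd]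
    | succ n ih =>
      obtain ⟨h, hh⟩ := ih
      obtain ⟨h', hh'⟩ := step n h hh
      refine ⟨h', fun x => ?_⟩
      rw [map_sub, hh', res_dd]
      simp
  obtain ⟨h, hh⟩ := claim n
  obtain ⟨h', hh'⟩ := step n h hh
  exact ⟨h, h', hh'⟩

lemma split_ann_ext {R : Type u} [CommRing R] (M N : ModuleCat.{u} R)
    (r : R) (k : ℕ) (s : M →ₗ[R] (Fin k → R)) (p : (Fin k → R) →ₗ[R] M)
    (hsp : ∀ x, p (s x) = r • x) (n : ℕ) :
    r ∈ Module.annihilator R (((Ext R (ModuleCat.{u} R) (n + 1)).obj (op M)).obj N) := by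
  rw [mem_ann_ext (projectiveResolution M)]
  intro f hf
  obtain ⟨h, h', hh⟩ := homotopy_exists (projectiveResolution M) r k s p hsp n
  refine ⟨f ∘ₗ h, LinearMap.ext fun x => ?_⟩
  have h1 := congrArg f (hh x)
  have h2 := LinearMap.congr_fun hf (h' x)
  simp only [LinearMap.comp_apply, LinearMap.zero_apply] at h2
  rw [h2, map_sub, map_smul] at h1
  exact (sub_eq_zero.1 h1.symm).symm

lemma split_ann_tor {R : Type u} [CommRing R] (A M : ModuleCat.{u} R)
    (r : R) (k : ℕ) (s : M →ₗ[R] (Fin k → R)) (p : (Fin k → R) →ₗ[R] M)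
    (hsp : ∀ x, p (s x) = r • x) (n : ℕ) :
    r ∈ Module.annihilator R (((Tor (ModuleCat.{u} R) (n + 1)).obj A).obj M) := by
  rw [mem_ann_tor A (projectiveResolution M)]
  intro z hz
  obtain ⟨h, h', hh⟩ := homotopy_exists (projectiveResolution M) r k s p hsp n
  refine ⟨LinearMap.lTensor A h' z, ?_⟩
  have e : ((projectiveResolution M).complex.d (n + 2) (n + 1)).hom ∘ₗ h' =
      r • LinearMap.id - h ∘ₗ ((projectiveResolution M).complex.d (n + 1) n).hom :=
    LinearMap.ext hh
  rw [← LinearMap.comp_apply, ← LinearMap.lTensor_comp, e, LinearMap.lTensor_sub,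
    LinearMap.lTensor_comp, LinearMap.lTensor_smul]
  simp [hz]

/-- Comparison argument for `Ext^2`. -/
lemma ext_two {R : Type u} [CommRing R] (M : ModuleCat.{u} R) {F0 F1 : Type u}
    [AddCommGroup F0] [AddCommGroup F1] [Module R F0] [Module R F1]
    [Module.Projective R F0] [Module.Projective R F1]
    (q : F0 →ₗ[R] M) (hq : Function.Surjective q) (b : F1 →ₗ[R] F0)
    (hqb : ∀ x, q (b x) = 0) (hex : ∀ x, q x = 0 → ∃ y, b y = x) (r : R)
    (hr : r ∈ Module.annihilator R (((Ext R (ModuleCat.{u} R) 2).obj (op M)).obj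
      (ModuleCat.of R (LinearMap.ker b)))) :
    ∃ h : F1 →ₗ[R] LinearMap.ker b, ∀ x : LinearMap.ker b, h x = r • x := by
  set P := projectiveResolution M
  have hP := res_proj P
  rw [mem_ann_ext P] at hr
  obtain ⟨ε, hε, hεex, hεd⟩ := res_zero P
  obtain ⟨f0, hf0⟩ := lift_surj q hq ε
  obtain ⟨g0, hg0⟩ := lift_surj ε hε q
  obtain ⟨f1, hf1⟩ := lift_exact b q hex (f0 ∘ₗ (P.complex.d 1 0).hom) (by
    intro p; simp [hf0, hεd])
  obtain ⟨g1, hg1⟩ := lift_exact _ ε hεex (g0 ∘ₗ b) (by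
    intro p; simp [hg0, hqb])
  obtain ⟨σ, hσ⟩ := lift_exact b q hex (f0 ∘ₗ g0 - LinearMap.id) (by
    intro p; simp [hf0, hg0])
  simp only [LinearMap.comp_apply, LinearMap.sub_apply, LinearMap.id_apply] at hf1 hg1 hσ
  let τ : F1 →ₗ[R] LinearMap.ker b :=
    (f1 ∘ₗ g1 - LinearMap.id - σ ∘ₗ b).codRestrict _ (by
      intro x
      simp [hf1, hg1, hσ])
  let f2 : P.complex.X 2 →ₗ[R] LinearMap.ker b :=
    (f1 ∘ₗ (P.complex.d 2 1).hom).codRestrict _ (by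
      intro x
      have h0 : (P.complex.d 1 0).hom ((P.complex.d 2 1).hom x) = 0 := res_dd P 0 x
      simp [hf1, h0])
  obtain ⟨h, hh⟩ := hr f2 (by
    ext x
    have h0 : (P.complex.d 2 1).hom ((P.complex.d 3 2).hom x) = 0 := res_dd P 1 x
    simp [f2, h0])
  refine ⟨h ∘ₗ g1 - r • τ, fun x => ?_⟩
  have hx : b x.1 = 0 := x.2
  obtain ⟨y, hy⟩ := res_exact_s15 P 0 (g1 x.1) (by
    have := hg1 x.1
    rw [hx, map_zero] at this
    exact this)
  have h1 : h (g1 x.1) = r • f2 y := by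
    rw [← hy]; exact LinearMap.congr_fun hh y
  apply Subtype.ext
  have h2 : (f2 y).1 = f1 (g1 x.1) := by rw [← hy]; rfl
  have h3 : (τ x.1).1 = f1 (g1 x.1) - x.1 := by
    simp [τ, hx]
  simp only [LinearMap.sub_apply, LinearMap.comp_apply, LinearMap.smul_apply, h1,
    Submodule.coe_sub, Submodule.coe_smul, h2, h3]
  rw [smul_sub]; abel

/-- Comparison argument for `Tor_1`. -/
lemma tor_one {R : Type u} [CommRing R] (A B : ModuleCat.{u} R) {F0 : Type u}
    [AddCommGroup F0] [Module R F0] [Module.Projective R F0]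
    (q : F0 →ₗ[R] B) (hq : Function.Surjective q) (r : R)
    (hr : r ∈ Module.annihilator R (((Tor (ModuleCat.{u} R) 1).obj A).obj B))
    (ζ : TensorProduct R A (LinearMap.ker q))
    (hζ : LinearMap.lTensor A (LinearMap.ker q).subtype ζ = 0) : r • ζ = 0 := by
  set P := projectiveResolution B
  have hP := res_proj P
  rw [mem_ann_tor A P] at hr
  obtain ⟨ε, hε, hεex, hεd⟩ := res_zero P
  obtain ⟨f, hf⟩ := lift_surj q hq ε
  obtain ⟨g, hg⟩ := lift_surj ε hε q
  let pi : P.complex.X 1 →ₗ[R] LinearMap.ker ε :=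
    ((P.complex.d 1 0).hom).codRestrict _ hεd
  have hpi : Function.Surjective pi := by
    rintro ⟨x, hx⟩
    obtain ⟨y, hy⟩ := hεex x hx
    exact ⟨y, Subtype.ext hy⟩
  let gW : LinearMap.ker q →ₗ[R] LinearMap.ker ε :=
    (g ∘ₗ (LinearMap.ker q).subtype).codRestrict _ (by
      intro x
      simp [hg])
  let fW : LinearMap.ker ε →ₗ[R] LinearMap.ker q :=
    (f ∘ₗ (LinearMap.ker ε).subtype).codRestrict _ (by
      intro x
      simp [hf])
  let θ : F0 →ₗ[R] LinearMap.ker q :=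
    (f ∘ₗ g - LinearMap.id).codRestrict _ (by
      intro x
      simp [hf, hg])
  obtain ⟨z, hz⟩ := LinearMap.lTensor_surjective A hpi (LinearMap.lTensor A gW ζ)
  have e1 : (P.complex.d 1 0).hom = (LinearMap.ker ε).subtype ∘ₗ pi := rfl
  have e2 : (LinearMap.ker ε).subtype ∘ₗ gW = g ∘ₗ (LinearMap.ker q).subtype := rfl
  have e3 : pi ∘ₗ (P.complex.d 2 1).hom = 0 := by
    ext x
    exact res_dd P 0 x
  have e4 : fW ∘ₗ gW = LinearMap.id + θ ∘ₗ (LinearMap.ker q).subtype := by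
    ext x
    change f (g x.1) = x.1 + (f (g x.1) - x.1)
    abel
  obtain ⟨w, hw⟩ := hr z (by
    change LinearMap.lTensor A (P.complex.d 1 0).hom z = 0
    rw [e1, LinearMap.lTensor_comp, LinearMap.comp_apply, hz, ← LinearMap.comp_apply,
      ← LinearMap.lTensor_comp, e2, LinearMap.lTensor_comp, LinearMap.comp_apply, hζ, map_zero])
  have h1 : r • LinearMap.lTensor A gW ζ = 0 := by
    rw [← hz, ← map_smul, ← hw, ← LinearMap.comp_apply]
    change (LinearMap.lTensor A pi ∘ₗ LinearMap.lTensor A (P.complex.d 2 1).hom) w = 0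
    rw [← LinearMap.lTensor_comp, e3]
    simp
  have h2 := congrArg (LinearMap.lTensor A fW) h1
  rw [map_smul, ← LinearMap.comp_apply, ← LinearMap.lTensor_comp, e4, LinearMap.lTensor_add,
    LinearMap.lTensor_comp, LinearMap.add_apply, LinearMap.comp_apply, hζ, map_zero, map_zero,
    add_zero, LinearMap.lTensor_id, LinearMap.id_apply] at h2
  exact h2


/-- The saturated rank one submodule of `R^n` attached to a tuple of fractions. -/
def Wsub {R Q : Type*} [CommRing R] [CommRing Q] [Algebra R Q] {n : ℕ} (q : Fin n → Q) :
    Submodule R (Fin n → R) where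
  carrier := {v | ∃ t : Q, ∀ i, algebraMap R Q (v i) = t * q i}
  add_mem' := by
    rintro v w ⟨t, ht⟩ ⟨t', ht'⟩
    refine ⟨t + t', fun i => ?_⟩
    simp [ht, ht', add_mul]
  zero_mem' := ⟨0, by simp⟩
  smul_mem' := by
    rintro a v ⟨t, ht⟩
    refine ⟨algebraMap R Q a * t, fun i => ?_⟩
    simp [ht, mul_assoc]

lemma mem_Wsub {R Q : Type*} [CommRing R] [CommRing Q] [Algebra R Q] {n : ℕ} (q : Fin n → Q)
    (v : Fin n → R) : v ∈ Wsub (R := R) q ↔ ∃ t : Q, ∀ i, algebraMap R Q (v i) = t * q i := Iff.rfl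

lemma Wsub_torsion {R Q : Type*} [CommRing R] [CommRing Q] [Algebra R Q]
    [IsLocalization (nonZeroDivisors R) Q] {n : ℕ} (q : Fin n → Q) :
    Submodule.torsion R ((Fin n → R) ⧸ Wsub (R := R) q) = ⊥ := by
  rw [eq_bot_iff]
  intro z hz
  obtain ⟨a, ha⟩ := (Submodule.mem_torsion_iff z).1 hz
  obtain ⟨v, rfl⟩ := Submodule.Quotient.mk_surjective _ z
  have h1 : Submodule.Quotient.mk (p := Wsub (R := R) q) (a.1 • v) = 0 := ha
  rw [Submodule.Quotient.mk_eq_zero, mem_Wsub] at h1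
  obtain ⟨t, ht⟩ := h1
  rw [Submodule.mem_bot, Submodule.Quotient.mk_eq_zero, mem_Wsub]
  have hu : IsUnit (algebraMap R Q a.1) := IsLocalization.map_units Q a
  obtain ⟨b, hb⟩ := hu.exists_right_inv
  refine ⟨b * t, fun i => ?_⟩
  have := ht i
  simp only [Pi.smul_apply, smul_eq_mul, map_mul] at this
  rw [mul_assoc, ← this, ← mul_assoc, mul_comm b, hb, one_mul]

lemma ker_torsion {R : Type*} [CommRing R] {k : ℕ} (K : Submodule R (Fin k → R)) :
    Submodule.torsion R K = ⊥ := by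
  rw [eq_bot_iff]
  intro z hz
  obtain ⟨a, ha⟩ := (Submodule.mem_torsion_iff z).1 hz
  rw [Submodule.mem_bot]
  apply Subtype.ext
  funext i
  have h1 : a.1 * z.1 i = 0 := congrFun (congrArg Subtype.val ha) i
  have h2 := a.2
  rw [mul_comm] at h1
  exact (mem_nonZeroDivisors_iff_right.1 h2) _ h1

/-- The conductor of `R` in a subalgebra. -/
def condS {R Q : Type*} [CommRing R] [CommRing Q] [Algebra R Q] (S : Subalgebra R Q) :
    Ideal R where
  carrier := {a | ∀ y ∈ S, ∃ ρ : R, algebraMap R Q ρ = algebraMap R Q a * y}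
  add_mem' := by
    intro a b ha hb y hy
    obtain ⟨ρ, h⟩ := ha y hy
    obtain ⟨ρ', h'⟩ := hb y hy
    exact ⟨ρ + ρ', by simp [h, h', add_mul]⟩
  zero_mem' := fun y _ => ⟨0, by simp⟩
  smul_mem' := by
    intro c a ha y hy
    obtain ⟨ρ, h⟩ := ha y hy
    exact ⟨c * ρ, by simp [h, mul_assoc]⟩

lemma condS_mul {R Q : Type*} [CommRing R] [CommRing Q] [Algebra R Q] {S : Subalgebra R Q}
    {a : R} (ha : a ∈ condS S) {y : Q} (hy : y ∈ S) :
    ∃ a' ∈ condS S, algebraMap R Q a' = algebraMap R Q a * y := by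
  obtain ⟨a', h⟩ := ha y hy
  refine ⟨a', fun y' hy' => ?_, h⟩
  obtain ⟨ρ, hρ⟩ := ha (y * y') (S.mul_mem hy hy')
  exact ⟨ρ, by rw [hρ, h, mul_assoc]⟩

lemma setup_S {R Q : Type*} [CommRing R] [CommRing Q] [Algebra R Q]
    [IsLocalization (nonZeroDivisors R) Q] (x : Q) (hx : IsIntegral R x) :
    ∃ (S : Subalgebra R Q) (n : ℕ) (s : Fin n → Q) (l : (Fin n → R) →ₗ[R] R),
      x ∈ S ∧ (∀ i, s i ∈ S) ∧
      (∀ v ∈ Wsub (R := R) s, l v ∈ condS S ∧ ∀ i, algebraMap R Q (v i) =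
        algebraMap R Q (l v) * s i) ∧
      (∀ a ∈ condS S, ∃ v ∈ Wsub (R := R) s, l v = a) ∧
      ∃ d ∈ condS S, d ∈ nonZeroDivisors R := by
  have hfg : (Subalgebra.toSubmodule (Algebra.adjoin R {x})).FG := hx.fg_adjoin_singleton
  obtain ⟨n, s, hs⟩ := Submodule.fg_iff_exists_fin_generating_family.1 hfg
  have hsS : ∀ i, s i ∈ Algebra.adjoin R {x} := by
    intro i
    have : s i ∈ Submodule.span R (Set.range s) := Submodule.subset_span ⟨i, rfl⟩
    rw [hs] at this
    exact this
  have hspan : ∀ y ∈ Algebra.adjoin R {x}, ∃ c : Fin n → R, ∑ i, c i • s i = y := by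
    intro y hy
    have : y ∈ Submodule.span R (Set.range s) := by rw [hs]; exact hy
    exact (Submodule.mem_span_range_iff_exists_fun R).1 this
  obtain ⟨u, hu⟩ := hspan 1 (one_mem _)
  have key : ∀ t : Q, ∀ v : Fin n → R, (∀ i, algebraMap R Q (v i) = t * s i) →
      ∀ y ∈ Algebra.adjoin R {x}, ∃ ρ, algebraMap R Q ρ = t * y := by
    intro t v hv y hy
    obtain ⟨c, rfl⟩ := hspan y hy
    refine ⟨∑ i, c i * v i, ?_⟩
    simp only [map_sum, map_mul, hv, Finset.mul_sum, Algebra.smul_def]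
    exact Finset.sum_congr rfl fun i _ => by ring
  let l : (Fin n → R) →ₗ[R] R := ∑ i, u i • LinearMap.proj i
  have hl : ∀ v t, (∀ i, algebraMap R Q (v i) = t * s i) → algebraMap R Q (l v) = t := by
    intro v t hv
    have : l v = ∑ i, u i * v i := by simp [l]
    rw [this]
    simp only [map_sum, map_mul, hv]
    calc _ = t * ∑ i, u i • s i := by
          simp only [Finset.mul_sum, Algebra.smul_def]
          exact Finset.sum_congr rfl fun i _ => by ring
      _ = t := by rw [hu, mul_one]
  refine ⟨Algebra.adjoin R {x}, n, s, l, Algebra.self_mem_adjoin_singleton R x, hsS, ?_, ?_, ?_⟩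
  · rintro v ⟨t, ht⟩
    have := hl v t ht
    refine ⟨fun y hy => ?_, fun i => ?_⟩
    · rw [this]; exact key t v ht y hy
    · rw [this]; exact ht i
  · intro a ha
    choose v hv using fun i => ha (s i) (hsS i)
    refine ⟨v, ⟨_, hv⟩, ?_⟩
    exact IsLocalization.injective Q (le_refl (nonZeroDivisors R)) (hl v _ hv)
  · obtain ⟨b, hb⟩ := IsLocalization.exist_integer_multiples_of_finite (nonZeroDivisors R) s
    choose v hv using hb
    refine ⟨b, key _ v (fun i => ?_), b.2⟩
    rw [hv i, Algebra.smul_def]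

lemma final_ext {R : Type u} {Q : Type*} [CommRing R] [IsNoetherianRing R] [CommRing Q]
    [Algebra R Q] [IsLocalization (nonZeroDivisors R) Q] (x : Q) (hx : IsIntegral R x) (r : R)
    (hr : ∀ (M : ModuleCat.{u} R) (_ : Module.Finite R M) (_ : Submodule.torsion R M = ⊥)
        (N : ModuleCat.{u} R) (_ : Module.Finite R N) (_ : Submodule.torsion R N = ⊥),
        r ∈ Module.annihilator R (((Ext R (ModuleCat.{u} R) 2).obj (op M)).obj N)) :
    ∃ ρ : R, algebraMap R Q ρ = algebraMap R Q r * x := by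
  have inj := IsLocalization.injective Q (le_refl (nonZeroDivisors R))
  obtain ⟨S, n, s, l, hxS, hsS, hW1, hW2, d, hdC, hd⟩ := setup_S (R := R) x hx
  obtain ⟨k, w, hw⟩ := Submodule.fg_iff_exists_fin_generating_family.1
    (IsNoetherian.noetherian (Wsub (R := R) s))
  let b : (Fin k → R) →ₗ[R] (Fin n → R) := Fintype.linearCombination R w
  have hb : LinearMap.range b = Wsub (R := R) s := by
    rw [Fintype.range_linearCombination, hw]
  have hbmem : ∀ e, b e ∈ Wsub (R := R) s := fun e => by
    rw [← hb]; exact ⟨e, rfl⟩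
  obtain ⟨h, hh⟩ := ext_two (ModuleCat.of R ((Fin n → R) ⧸ Wsub (R := R) s))
    (Wsub (R := R) s).mkQ (Submodule.mkQ_surjective _) b
    (by
      intro e
      rw [Submodule.mkQ_apply, Submodule.Quotient.mk_eq_zero]
      exact hbmem e)
    (by
      intro v hv
      rw [Submodule.mkQ_apply, Submodule.Quotient.mk_eq_zero, ← hb] at hv
      exact hv) r
    (hr _ (inferInstanceAs (Module.Finite R ((Fin n → R) ⧸ Wsub (R := R) s)))
      (Wsub_torsion s) _ (inferInstanceAs (Module.Finite R (LinearMap.ker b))) (ker_torsion _))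
  let φ : (Fin k → R) →ₗ[R] (Fin k → R) := r • LinearMap.id - (LinearMap.ker b).subtype ∘ₗ h
  have hφ : ∀ e, b e = 0 → φ e = 0 := by
    intro e he
    have := congrArg Subtype.val (hh ⟨e, he⟩)
    change r • e - (h e).1 = 0
    rw [sub_eq_zero]
    exact this.symm
  have hbφ : ∀ e, b (φ e) = r • b e := by
    intro e
    change b (r • e - (h e).1) = _
    have : b (h e).1 = 0 := (h e).2
    rw [map_sub, this, map_smul, sub_zero]
  have hex : ∀ a ∈ condS S, ∃ e, l (b e) = a := by
    intro a ha
    obtain ⟨v, hv, rfl⟩ := hW2 a ha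
    rw [← hb] at hv
    obtain ⟨e, rfl⟩ := hv
    exact ⟨e, rfl⟩
  obtain ⟨ed, hed⟩ := hex d hdC
  have hcomm : ∀ e, l (b e) • φ ed = d • φ e := by
    intro e
    rw [← sub_eq_zero, ← map_smul, ← map_smul, ← map_sub]
    apply hφ
    rw [map_sub, map_smul, map_smul, sub_eq_zero]
    funext i
    apply inj
    simp only [Pi.smul_apply, smul_eq_mul, map_mul, (hW1 _ (hbmem _)).2 i, hed]
    ring
  have hsum : ∀ e : Fin k → R, l (b e) = ∑ j, e j * l (w j) := by
    intro e
    simp [b, Fintype.linearCombination_apply]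
  have hwC : ∀ j, l (w j) ∈ condS S := by
    intro j
    refine (hW1 (w j) ?_).1
    rw [← hw]; exact Submodule.subset_span ⟨j, rfl⟩
  choose c' hc'C hc' using fun j => condS_mul (hwC j) hxS
  choose e' he' using fun j => hex (c' j) (hc'C j)
  refine ⟨∑ j, φ (e' j) j, ?_⟩
  have hu : IsUnit (algebraMap R Q d) := IsLocalization.map_units Q ⟨d, hd⟩
  apply hu.mul_left_cancel
  have h1 : r * d = ∑ j, φ ed j * l (w j) := by
    rw [← hsum, hbφ, map_smul, hed, smul_eq_mul]
  have h2 : d * ∑ j, φ (e' j) j = ∑ j, φ ed j * c' j := by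
    rw [Finset.mul_sum]
    refine Finset.sum_congr rfl fun j _ => ?_
    have := congrFun (hcomm (e' j)) j
    rw [he'] at this
    simp only [Pi.smul_apply, smul_eq_mul] at this
    rw [← this, mul_comm]
  rw [← map_mul, h2, ← mul_assoc, ← map_mul, mul_comm d r, h1]
  simp only [map_sum, map_mul, hc', Finset.sum_mul]
  exact Finset.sum_congr rfl fun i _ => by ring

lemma final_tor {R : Type u} {Q : Type*} [CommRing R] [IsNoetherianRing R] [CommRing Q]
    [Algebra R Q] [IsLocalization (nonZeroDivisors R) Q] (x : Q) (hx : IsIntegral R x) (r : R)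
    (hr : ∀ (M : ModuleCat.{u} R) (_ : Module.Finite R M) (_ : Submodule.torsion R M = ⊥)
        (N : ModuleCat.{u} R) (_ : Module.Finite R N) (_ : Submodule.torsion R N = ⊥),
        r ∈ Module.annihilator R (((Tor (ModuleCat.{u} R) 1).obj M).obj N)) :
    ∃ ρ : R, algebraMap R Q ρ = algebraMap R Q r * x := by
  have inj := IsLocalization.injective Q (le_refl (nonZeroDivisors R))
  obtain ⟨S, n, s, l, hxS, hsS, hW1, hW2, d, hdC, hd⟩ := setup_S (R := R) x hx
  obtain ⟨k, c, hc⟩ := Submodule.fg_iff_exists_fin_generating_family.1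
    (IsNoetherian.noetherian (condS S))
  have hcC : ∀ j, c j ∈ condS S := by
    intro j
    rw [← hc]; exact Submodule.subset_span ⟨j, rfl⟩
  have hspan : ∀ a ∈ condS S, ∃ α : Fin k → R, ∑ i, α i * c i = a := by
    intro a ha
    rw [← hc] at ha
    exact (Submodule.mem_span_range_iff_exists_fun R).1 ha
  let cq : Fin k → Q := fun j => algebraMap R Q (c j)
  let q := (Wsub (R := R) s).mkQ
  have hker : LinearMap.ker q = Wsub (R := R) s := Submodule.ker_mkQ _
  choose w hwW hwl using fun j => hW2 (c j) (hcC j)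
  have hwk : ∀ j, w j ∈ LinearMap.ker q := fun j => by rw [hker]; exact hwW j
  let bas : Fin k → (Fin k → R) := fun j => Pi.single j 1
  let A := (Fin k → R) ⧸ Wsub (R := R) cq
  let ζ : TensorProduct R A (LinearMap.ker q) :=
    ∑ j, TensorProduct.tmul R ((Wsub (R := R) cq).mkQ (bas j)) ⟨w j, hwk j⟩
  have hζ : LinearMap.lTensor A (LinearMap.ker q).subtype ζ = 0 := by
    have e1 : ∀ j, w j = ∑ i, w j i • (Pi.single i 1 : Fin n → R) := fun j =>
      pi_eq_sum_univ' (w j)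
    simp only [ζ, map_sum, LinearMap.lTensor_tmul, Submodule.subtype_apply]
    calc _ = ∑ j, ∑ i, TensorProduct.tmul R (w j i • ((Wsub (R := R) cq).mkQ (bas j)))
            (Pi.single i 1 : Fin n → R) := by
          refine Finset.sum_congr rfl fun j _ => ?_
          conv_lhs => rw [e1 j]
          rw [TensorProduct.tmul_sum]
          refine Finset.sum_congr rfl fun i _ => ?_
          rw [TensorProduct.tmul_smul, TensorProduct.smul_tmul']
      _ = ∑ i, TensorProduct.tmul R (∑ j, w j i • ((Wsub (R := R) cq).mkQ (bas j)))
            (Pi.single i 1 : Fin n → R) := by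
          rw [Finset.sum_comm]
          refine Finset.sum_congr rfl fun i _ => ?_
          rw [TensorProduct.sum_tmul]
      _ = 0 := by
          refine Finset.sum_eq_zero fun i _ => ?_
          have : ∑ j, w j i • ((Wsub (R := R) cq).mkQ (bas j)) = 0 := by
            simp only [← map_smul, ← map_sum]
            have e2 : ∑ j, w j i • bas j = fun j => w j i := (pi_eq_sum_univ' _).symm
            rw [e2, Submodule.mkQ_apply, Submodule.Quotient.mk_eq_zero]
            refine ⟨s i, fun j => ?_⟩
            rw [(hW1 _ (hwW j)).2 i, hwl, mul_comm]
          rw [this, TensorProduct.zero_tmul]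
  have hz := tor_one (ModuleCat.of R A) (ModuleCat.of R ((Fin n → R) ⧸ Wsub (R := R) s))
    q (Submodule.mkQ_surjective _) r
    (hr _ (inferInstanceAs (Module.Finite R ((Fin k → R) ⧸ Wsub (R := R) cq)))
      (Wsub_torsion cq) _ (inferInstanceAs (Module.Finite R ((Fin n → R) ⧸ Wsub (R := R) s)))
      (Wsub_torsion s)) ζ hζ
  let T : Submodule R (Fin k → R) := Submodule.span R
    {u | ∃ v ∈ Wsub (R := R) cq, ∃ y ∈ Wsub (R := R) s, u = l y • v}
  let β0 : (Fin k → R) →ₗ[R] LinearMap.ker q →ₗ[R] ((Fin k → R) ⧸ T) :=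
    LinearMap.mk₂ R (fun v y => T.mkQ (l y.1 • v))
      (by intros; simp [smul_add])
      (by intro a v y; rw [smul_comm, map_smul])
      (by intros; simp [add_smul])
      (by intros; simp [mul_smul])
  let β : A →ₗ[R] LinearMap.ker q →ₗ[R] ((Fin k → R) ⧸ T) :=
    (Wsub (R := R) cq).liftQ β0 (by
      intro v hv
      rw [LinearMap.mem_ker]
      ext y
      change T.mkQ (l y.1 • v) = 0
      rw [Submodule.mkQ_apply, Submodule.Quotient.mk_eq_zero]
      exact Submodule.subset_span ⟨v, hv, y.1, hker.le y.2, rfl⟩)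
  have h3 := congrArg (TensorProduct.lift β) hz
  have h4 : TensorProduct.lift β ζ = T.mkQ c := by
    simp only [ζ, map_sum, TensorProduct.lift.tmul]
    have : ∀ j, β ((Wsub (R := R) cq).mkQ (bas j)) ⟨w j, hwk j⟩ = T.mkQ (c j • bas j) := by
      intro j
      change T.mkQ (l (w j) • bas j) = _
      rw [hwl]
    simp only [this, ← map_sum]
    congr 1
    exact (pi_eq_sum_univ' c).symm
  rw [map_smul, h4, map_zero, ← map_smul, Submodule.mkQ_apply,
    Submodule.Quotient.mk_eq_zero] at h3
  have hT : ∀ u ∈ T, ∃ τ : Q, (∀ j, algebraMap R Q (u j) = τ * cq j) ∧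
      ∃ ρ : R, algebraMap R Q ρ = τ * x := by
    intro u hu
    induction hu using Submodule.span_induction with
    | mem u hu =>
      obtain ⟨v, ⟨t, ht⟩, y, hy, rfl⟩ := hu
      refine ⟨algebraMap R Q (l y) * t, fun j => ?_, ?_⟩
      · simp [ht, mul_assoc]
      · obtain ⟨a', ha', he⟩ := condS_mul (hW1 y hy).1 hxS
        obtain ⟨α, rfl⟩ := hspan a' ha'
        refine ⟨∑ i, α i * v i, ?_⟩
        rw [mul_right_comm, ← he]
        simp only [map_sum, map_mul, ht, Finset.sum_mul, cq]
        exact Finset.sum_congr rfl fun i _ => by ring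
    | zero => exact ⟨0, by simp, 0, by simp⟩
    | add u v _ _ hu hv =>
      obtain ⟨τ, h1, ρ, h2⟩ := hu
      obtain ⟨τ', h1', ρ', h2'⟩ := hv
      exact ⟨τ + τ', fun j => by simp [h1, h1', add_mul], ρ + ρ', by simp [h2, h2', add_mul]⟩
    | smul a u _ hu =>
      obtain ⟨τ, h1, ρ, h2⟩ := hu
      exact ⟨algebraMap R Q a * τ, fun j => by simp [h1, mul_assoc], a * ρ,
        by simp [h2, mul_assoc]⟩
  obtain ⟨τ, h5, ρ, h6⟩ := hT _ h3
  have hu : IsUnit (algebraMap R Q d) := IsLocalization.map_units Q ⟨d, hd⟩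
  have h7 : algebraMap R Q r = τ := by
    apply hu.mul_left_cancel
    obtain ⟨α, hα⟩ := hspan d hdC
    rw [← hα]
    simp only [map_sum, map_mul, Finset.sum_mul]
    refine Finset.sum_congr rfl fun i _ => ?_
    have := h5 i
    simp only [Pi.smul_apply, smul_eq_mul, map_mul, cq] at this
    rw [mul_assoc, mul_comm (algebraMap R Q (c i)), this]
    ring
  exact ⟨ρ, by rw [h6, h7]⟩

/-- Let `(R, 𝔪)` be a one-dimensional Noetherian local ring whose `𝔪`-adic completion is
reduced.  Then the conductor `𝒞(R)` equals
(i) the intersection over all `i ≥ 1` and all finitely generated torsion-free `R`-modules `M, N`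
of the annihilators of `Ext^i_R(M, N)`,
(ii) the same intersection taken over `i ≥ 2`, and
(iii) the intersection over all `i ≥ 1` and all finitely generated torsion-free `R`-modules
`M, N` of the annihilators of `Tor_i^R(M, N)`. -/
theorem conductor_eq_ann_ext_tor_CM (R : Type u) [CommRing R] [IsNoetherianRing R]
    [IsLocalRing R] (hdim : ringKrullDim R = 1)
    (hred : IsReduced (AdicCompletion (IsLocalRing.maximalIdeal R) R)) :
    (conductorIdeal R =
      ⨅ (i : ℕ) (_ : 1 ≤ i)
        (M : ModuleCat.{u} R) (_ : Module.Finite R M) (_ : Submodule.torsion R M = ⊥)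
        (N : ModuleCat.{u} R) (_ : Module.Finite R N) (_ : Submodule.torsion R N = ⊥),
        Module.annihilator R (((Ext R (ModuleCat.{u} R) i).obj (op M)).obj N)) ∧
    (conductorIdeal R =
      ⨅ (i : ℕ) (_ : 2 ≤ i)
        (M : ModuleCat.{u} R) (_ : Module.Finite R M) (_ : Submodule.torsion R M = ⊥)
        (N : ModuleCat.{u} R) (_ : Module.Finite R N) (_ : Submodule.torsion R N = ⊥),
        Module.annihilator R (((Ext R (ModuleCat.{u} R) i).obj (op M)).obj N)) ∧
    (conductorIdeal R =
      ⨅ (i : ℕ) (_ : 1 ≤ i)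
        (M : ModuleCat.{u} R) (_ : Module.Finite R M) (_ : Submodule.torsion R M = ⊥)
        (N : ModuleCat.{u} R) (_ : Module.Finite R N) (_ : Submodule.torsion R N = ⊥),
        Module.annihilator R (((Tor (ModuleCat.{u} R) i).obj M).obj N)) := by
  have hR : IsReduced R := by
    have hinj : Function.Injective
        (algebraMap R (AdicCompletion (IsLocalRing.maximalIdeal R) R)) :=
      AdicCompletion.of_injective (IsLocalRing.maximalIdeal R) R
    exact isReduced_of_injective _ hinj
  have hK : Ring.KrullDimLE 1 R := by
    rw [Ring.krullDimLE_iff, hdim]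
    exact le_refl _
  have hE : ∀ c ∈ conductorIdeal R, ∀ (n : ℕ) (M : ModuleCat.{u} R) (_ : Module.Finite R M)
      (_ : Submodule.torsion R M = ⊥) (N : ModuleCat.{u} R),
      c ∈ Module.annihilator R (((Ext R (ModuleCat.{u} R) (n + 1)).obj (op M)).obj N) := by
    intro c hc n M hM hMt N
    obtain ⟨k, s, p, hsp⟩ := core_split R c hc M hMt
    exact split_ann_ext M N c k s p hsp n
  have hT : ∀ c ∈ conductorIdeal R, ∀ (n : ℕ) (M : ModuleCat.{u} R) (_ : Module.Finite R M)
      (_ : Submodule.torsion R M = ⊥) (A : ModuleCat.{u} R),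
      c ∈ Module.annihilator R (((Tor (ModuleCat.{u} R) (n + 1)).obj A).obj M) := by
    intro c hc n M hM hMt A
    obtain ⟨k, s, p, hsp⟩ := core_split R c hc M hMt
    exact split_ann_tor A M c k s p hsp n
  refine ⟨le_antisymm ?_ ?_, le_antisymm ?_ ?_, le_antisymm ?_ ?_⟩
  · intro c hc
    simp only [Submodule.mem_iInf]
    intro i hi M hM hMt N hN hNt
    obtain ⟨n, rfl⟩ := Nat.exists_eq_add_of_le' hi
    exact hE c hc n M hM hMt N
  · intro c hc
    simp only [Submodule.mem_iInf] at hc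
    rw [mem_conductorIdeal_iff]
    intro y hy
    exact final_ext y hy c (hc 2 (by norm_num))
  · intro c hc
    simp only [Submodule.mem_iInf]
    intro i hi M hM hMt N hN hNt
    obtain ⟨n, rfl⟩ := Nat.exists_eq_add_of_le' hi
    exact hE c hc (n + 1) M hM hMt N
  · intro c hc
    simp only [Submodule.mem_iInf] at hc
    rw [mem_conductorIdeal_iff]
    intro y hy
    exact final_ext y hy c (hc 2 le_rfl)
  · intro c hc
    simp only [Submodule.mem_iInf]
    intro i hi M hM hMt N hN hNt
    obtain ⟨n, rfl⟩ := Nat.exists_eq_add_of_le' hi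
    exact hT c hc n N hN hNt M
  · intro c hc
    simp only [Submodule.mem_iInf] at hc
    rw [mem_conductorIdeal_iff]
    intro y hy
    exact final_tor y hy c (hc 1 le_rfl)
end
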